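/- arXiv:2105.06201 — 3 statements merged into one kernel-verified Lean document; each statement's English description precedes it below -/
import Mathlib

section
/- For all blocklengths n, m ≥ 1 and all rates R1, R2 ≥ 0, the sequence (n · D_e^n(R1,R2))_{n≥1} is sub-additive: n · D_e^n(R1,R2) + m · D_e^m(R1,R2) ≥ (n+m) · D_e^{n+m}(R1,R2). -/
open scoped BigOperators

namespace Persuasion

/-- `p` is a probability distribution on the finite alphabet `α`. -/
def IsDist {α : Type*} [Fintype α] (p : α → ℝ) : Prop :=
  (∀ a, 0 ≤ p a) ∧ ∑ a, p a = 1

/-- `k` is a stochastic map (transition kernel) from `α` to `β`. -/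
def IsKernel {α : Type*} {β : Type*} [Fintype β] (k : α → β → ℝ) : Prop :=
  ∀ a, IsDist (k a)

/-- Shannon entropy (in bits) of a distribution on a finite alphabet. -/
noncomputable def ent {α : Type*} [Fintype α] (p : α → ℝ) : ℝ :=
  - ∑ a, p a * Real.logb 2 (p a)

/-- Mutual information (in bits) computed from a joint distribution on `α × β`. -/
noncomputable def miOfJoint {α β : Type*} [Fintype α] [Fintype β] (p : α × β → ℝ) : ℝ :=
  ent (fun a => ∑ b, p (a, b)) + ent (fun b => ∑ a, p (a, b)) - ent p

/-- Message alphabet `{1, …, 2^⌊n·R⌋}` at rate `R` and blocklength `n`. -/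
abbrev Msg (R : ℝ) (n : ℕ) : Type := Fin (2 ^ ⌊(n : ℝ) * R⌋₊)

section Operational

variable {U V1 V2 M1 M2 : Type*} [Fintype U] [Fintype V1] [Fintype V2]
  [Fintype M1] [Fintype M2]

/-- Long-run encoder distortion `d_e^n(σ,τ1,τ2)`. -/
noncomputable def deN (PU : U → ℝ) (de : U → V1 → V2 → ℝ) {n : ℕ}
    (σ : (Fin n → U) → M1 × M2 → ℝ)
    (τ1 : M1 × M2 → (Fin n → V1) → ℝ)
    (τ2 : M2 → (Fin n → V2) → ℝ) : ℝ :=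
  ∑ un : Fin n → U, ∑ m1 : M1, ∑ m2 : M2, ∑ v1n : Fin n → V1, ∑ v2n : Fin n → V2,
    ((∏ t, PU (un t)) * σ un (m1, m2) * τ1 (m1, m2) v1n * τ2 m2 v2n) *
      ((n : ℝ)⁻¹ * ∑ t, de (un t) (v1n t) (v2n t))

/-- Long-run distortion `d_1^n(σ,τ1)` of the first decoder. -/
noncomputable def d1N (PU : U → ℝ) (d1 : U → V1 → ℝ) {n : ℕ}
    (σ : (Fin n → U) → M1 × M2 → ℝ)
    (τ1 : M1 × M2 → (Fin n → V1) → ℝ) : ℝ :=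
  ∑ un : Fin n → U, ∑ m1 : M1, ∑ m2 : M2, ∑ v1n : Fin n → V1,
    ((∏ t, PU (un t)) * σ un (m1, m2) * τ1 (m1, m2) v1n) *
      ((n : ℝ)⁻¹ * ∑ t, d1 (un t) (v1n t))

/-- Long-run distortion `d_2^n(σ,τ2)` of the second decoder. -/
noncomputable def d2N (PU : U → ℝ) (d2 : U → V2 → ℝ) {n : ℕ}
    (σ : (Fin n → U) → M1 × M2 → ℝ)
    (τ2 : M2 → (Fin n → V2) → ℝ) : ℝ :=
  ∑ un : Fin n → U, ∑ m1 : M1, ∑ m2 : M2, ∑ v2n : Fin n → V2,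
    ((∏ t, PU (un t)) * σ un (m1, m2) * τ2 m2 v2n) *
      ((n : ℝ)⁻¹ * ∑ t, d2 (un t) (v2n t))

/-- Best responses of decoder 1 to the encoding strategy `σ`. -/
def BR1 (PU : U → ℝ) (d1 : U → V1 → ℝ) {n : ℕ}
    (σ : (Fin n → U) → M1 × M2 → ℝ) :
    Set (M1 × M2 → (Fin n → V1) → ℝ) :=
  {τ1 | IsKernel τ1 ∧ ∀ τ1' : M1 × M2 → (Fin n → V1) → ℝ,
      IsKernel τ1' → d1N PU d1 σ τ1 ≤ d1N PU d1 σ τ1'}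

/-- Best responses of decoder 2 to the encoding strategy `σ`. -/
def BR2 (PU : U → ℝ) (d2 : U → V2 → ℝ) {n : ℕ}
    (σ : (Fin n → U) → M1 × M2 → ℝ) :
    Set (M2 → (Fin n → V2) → ℝ) :=
  {τ2 | IsKernel τ2 ∧ ∀ τ2' : M2 → (Fin n → V2) → ℝ,
      IsKernel τ2' → d2N PU d2 σ τ2 ≤ d2N PU d2 σ τ2'}

/-- Worst-case encoder distortion over the best responses of the two decoders. -/
noncomputable def DeWorst (PU : U → ℝ) (de : U → V1 → V2 → ℝ) (d1 : U → V1 → ℝ)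
    (d2 : U → V2 → ℝ) {n : ℕ} (σ : (Fin n → U) → M1 × M2 → ℝ) : ℝ :=
  sSup {y | ∃ τ1 ∈ BR1 PU d1 σ, ∃ τ2 ∈ BR2 PU d2 σ, y = deN PU de σ τ1 τ2}

end Operational

/-- Optimal `n`-letter encoder distortion `D_e^n(R1,R2)`. -/
noncomputable def Dn {U V1 V2 : Type*} [Fintype U] [Fintype V1] [Fintype V2]
    (PU : U → ℝ) (de : U → V1 → V2 → ℝ) (d1 : U → V1 → ℝ) (d2 : U → V2 → ℝ)
    (R1 R2 : ℝ) (n : ℕ) : ℝ :=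
  sInf {x | ∃ σ : (Fin n → U) → Msg R1 n × Msg R2 n → ℝ, IsKernel σ ∧
    x = DeWorst PU de d1 d2 σ}

section SingleLetter

variable {U V1 V2 W1 W2 : Type*} [Fintype U] [Fintype V1] [Fintype V2]
  [Fintype W1] [Fintype W2]

/-- The information-constraint set `Q0(R1,R2)` of conditional distributions. -/
noncomputable def Q0set (PU : U → ℝ) (R1 R2 : ℝ) : Set (U → W1 × W2 → ℝ) :=
  {Q | IsKernel Q ∧
    miOfJoint (fun p : U × W2 => ∑ w1, PU p.1 * Q p.1 (w1, p.2)) ≤ R2 ∧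
    miOfJoint (fun p : U × (W1 × W2) => PU p.1 * Q p.1 p.2) ≤ R1 + R2}

/-- Expected distortion `E[d_1(U,V1)]` under `P_U · Q_{W1W2|U} · Q_{V1|W1W2}`. -/
noncomputable def E1 (PU : U → ℝ) (d1 : U → V1 → ℝ) (Q : U → W1 × W2 → ℝ)
    (k1 : W1 × W2 → V1 → ℝ) : ℝ :=
  ∑ u, ∑ w : W1 × W2, ∑ v1, PU u * Q u w * k1 w v1 * d1 u v1

/-- Expected distortion `E[d_2(U,V2)]` under `P_U · Q_{W2|U} · Q_{V2|W2}`. -/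
noncomputable def E2 (PU : U → ℝ) (d2 : U → V2 → ℝ) (Q : U → W1 × W2 → ℝ)
    (k2 : W2 → V2 → ℝ) : ℝ :=
  ∑ u, ∑ w2 : W2, ∑ v2, PU u * (∑ w1, Q u (w1, w2)) * k2 w2 v2 * d2 u v2

/-- Single-letter best responses `Q1(Q_{W1W2|U})` of decoder 1. -/
def Q1set (PU : U → ℝ) (d1 : U → V1 → ℝ) (Q : U → W1 × W2 → ℝ) :
    Set (W1 × W2 → V1 → ℝ) :=
  {k1 | IsKernel k1 ∧ ∀ k1' : W1 × W2 → V1 → ℝ, IsKernel k1' →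
      E1 PU d1 Q k1 ≤ E1 PU d1 Q k1'}

/-- Single-letter best responses `Q2(Q_{W2|U})` of decoder 2. -/
def Q2set (PU : U → ℝ) (d2 : U → V2 → ℝ) (Q : U → W1 × W2 → ℝ) :
    Set (W2 → V2 → ℝ) :=
  {k2 | IsKernel k2 ∧ ∀ k2' : W2 → V2 → ℝ, IsKernel k2' →
      E2 PU d2 Q k2 ≤ E2 PU d2 Q k2'}

/-- Expected encoder distortion `E[d_e(U,V1,V2)]` under
`P_U · Q_{W1W2|U} · Q_{V1|W1W2} · Q_{V2|W2}`. -/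
noncomputable def Ee (PU : U → ℝ) (de : U → V1 → V2 → ℝ) (Q : U → W1 × W2 → ℝ)
    (k1 : W1 × W2 → V1 → ℝ) (k2 : W2 → V2 → ℝ) : ℝ :=
  ∑ u, ∑ w : W1 × W2, ∑ v1, ∑ v2,
    PU u * Q u w * k1 w v1 * k2 w.2 v2 * de u v1 v2

end SingleLetter

/-- Single-letter optimal encoder distortion `D_e*(R1,R2)`, with auxiliary
alphabets `W1`, `W2`. -/
noncomputable def Dstar (W1 W2 : Type*) [Fintype W1] [Fintype W2]
    {U V1 V2 : Type*} [Fintype U] [Fintype V1] [Fintype V2]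
    (PU : U → ℝ) (de : U → V1 → V2 → ℝ) (d1 : U → V1 → ℝ) (d2 : U → V2 → ℝ)
    (R1 R2 : ℝ) : ℝ :=
  sInf {x | ∃ Q : U → W1 × W2 → ℝ, Q ∈ Q0set PU R1 R2 ∧
    x = sSup {y | ∃ k1 ∈ Q1set PU d1 Q, ∃ k2 ∈ Q2set PU d2 Q,
      y = Ee PU de Q k1 k2}}


section Helpers

theorem sum_append {α : Type*} [Fintype α] {n m : ℕ} (f : (Fin (n + m) → α) → ℝ) :
    ∑ u, f u = ∑ x : Fin n → α, ∑ y : Fin m → α, f (Fin.append x y) := by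
  rw [← Fintype.sum_prod_type' (f := fun x y => f (Fin.append x y))]
  exact (Equiv.sum_comp (Fin.appendEquiv n m) f).symm

theorem sum_prodPU {U : Type*} [Fintype U] {PU : U → ℝ} (hPU : IsDist PU) (n : ℕ) :
    ∑ u : Fin n → U, ∏ t, PU (u t) = 1 := by
  classical
  have := Finset.prod_univ_sum (fun _ : Fin n => (Finset.univ : Finset U)) (fun _ u => PU u)
  rw [Fintype.piFinset_univ] at this
  rw [← this]
  simp [hPU.2]

theorem prodPU_nonneg {U : Type*} [Fintype U] {PU : U → ℝ} (hPU : IsDist PU) {n : ℕ}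
    (u : Fin n → U) : 0 ≤ ∏ t, PU (u t) := Finset.prod_nonneg fun _ _ => hPU.1 _

theorem isDist_single {α : Type*} [Fintype α] [DecidableEq α] (a : α) :
    IsDist (Pi.single a (1 : ℝ)) := by
  refine ⟨fun b => ?_, by simp⟩
  by_cases h : b = a
  · subst h; simp
  · simp [h]

theorem br_iff {M V : Type*} [Fintype M] [Fintype V] (c τ : M → V → ℝ) (hτ : IsKernel τ) :
    (∀ τ' : M → V → ℝ, IsKernel τ' → ∑ μ, ∑ v, τ μ v * c μ v ≤ ∑ μ, ∑ v, τ' μ v * c μ v) ↔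
      ∀ μ v, ∑ w, τ μ w * c μ w ≤ c μ v := by
  classical
  constructor
  · intro h μ v
    have := h (Function.update τ μ (Pi.single v 1)) (by
      intro μ'
      by_cases hh : μ' = μ
      · subst hh; simpa using isDist_single v
      · simpa [hh] using hτ μ')
    rw [← Finset.add_sum_erase _ _ (Finset.mem_univ μ),
      ← Finset.add_sum_erase (a := μ) _ (fun μ' => ∑ v', Function.update τ μ (Pi.single v 1) μ' v' * c μ' v') (Finset.mem_univ μ)] at this
    have h2 : ∑ x ∈ Finset.univ.erase μ, ∑ v', Function.update τ μ (Pi.single v 1) x v' * c x v'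
        = ∑ x ∈ Finset.univ.erase μ, ∑ v', τ x v' * c x v' := by
      refine Finset.sum_congr rfl fun x hx => ?_
      rw [Function.update_of_ne (Finset.ne_of_mem_erase hx)]
    rw [h2] at this
    have h3 : ∑ v', Function.update τ μ (Pi.single v 1) μ v' * c μ v' = c μ v := by
      simp [Pi.single_apply]
    linarith
  · intro h τ' hτ'
    refine Finset.sum_le_sum fun μ _ => ?_
    calc ∑ v, τ μ v * c μ v = ∑ v', τ' μ v' * ∑ v, τ μ v * c μ v := by
          rw [← Finset.sum_mul, (hτ' μ).2, one_mul]
      _ ≤ _ := Finset.sum_le_sum fun v' _ => mul_le_mul_of_nonneg_left (h μ v') ((hτ' μ).1 v')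

variable {U V V1 V2 M M' M1 M2 : Type*} [Fintype U] [Fintype V] [Fintype V1] [Fintype V2]
  [Fintype M] [Fintype M'] [Fintype M1] [Fintype M2]

noncomputable def cst (PU : U → ℝ) (d : U → V → ℝ) {n : ℕ} (ρ : (Fin n → U) → M → ℝ) (μ : M)
    (v : Fin n → V) : ℝ :=
  ∑ u : Fin n → U, (∏ t, PU (u t)) * ρ u μ * ∑ t, d (u t) (v t)

noncomputable def prb (PU : U → ℝ) {n : ℕ} (ρ : (Fin n → U) → M → ℝ) (μ : M) : ℝ :=
  ∑ u : Fin n → U, (∏ t, PU (u t)) * ρ u μ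

def IsBR (PU : U → ℝ) (d : U → V → ℝ) {n : ℕ} (ρ : (Fin n → U) → M → ℝ)
    (τ : M → (Fin n → V) → ℝ) : Prop :=
  IsKernel τ ∧ ∀ μ v, ∑ w, τ μ w * cst PU d ρ μ w ≤ cst PU d ρ μ v

noncomputable def mrg {n : ℕ} (σ : (Fin n → U) → M1 × M2 → ℝ) : (Fin n → U) → M2 → ℝ :=
  fun u m2 => ∑ m1, σ u (m1, m2)

theorem d1N_eq (PU : U → ℝ) (d1 : U → V1 → ℝ) {n : ℕ} (σ : (Fin n → U) → M1 × M2 → ℝ)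
    (τ : M1 × M2 → (Fin n → V1) → ℝ) :
    d1N PU d1 σ τ = (n : ℝ)⁻¹ * ∑ μ, ∑ v, τ μ v * cst PU d1 σ μ v := by
  unfold d1N cst
  simp_rw [← Fintype.sum_prod_type' (f := fun a b => ∑ v, ((∏ t, PU (_ : U)) * σ _ (a, b) * τ (a, b) v) * _)]
  simp_rw [Finset.mul_sum]
  rw [Finset.sum_comm]
  refine Finset.sum_congr rfl fun μ _ => ?_
  rw [Finset.sum_comm]
  refine Finset.sum_congr rfl fun v _ => Finset.sum_congr rfl fun u _ =>
    Finset.sum_congr rfl fun t _ => by ring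

theorem d2N_eq (PU : U → ℝ) (d2 : U → V2 → ℝ) {n : ℕ} (σ : (Fin n → U) → M1 × M2 → ℝ)
    (τ : M2 → (Fin n → V2) → ℝ) :
    d2N PU d2 σ τ = (n : ℝ)⁻¹ * ∑ μ, ∑ v, τ μ v * cst PU d2 (mrg σ) μ v := by
  unfold d2N cst mrg
  simp_rw [Finset.mul_sum, Finset.sum_mul, Finset.mul_sum]
  have : ∀ (f : (Fin n → U) → M1 → M2 → (Fin n → V2) → Fin n → ℝ),
      ∑ u, ∑ m1, ∑ m2, ∑ v, ∑ t, f u m1 m2 v t = ∑ m2, ∑ v, ∑ u, ∑ t, ∑ m1, f u m1 m2 v t := by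
    intro f
    calc _ = ∑ u, ∑ m2, ∑ m1, ∑ v, ∑ t, f u m1 m2 v t :=
          Finset.sum_congr rfl fun _ _ => Finset.sum_comm
      _ = ∑ m2, ∑ u, ∑ m1, ∑ v, ∑ t, f u m1 m2 v t := Finset.sum_comm
      _ = ∑ m2, ∑ u, ∑ v, ∑ m1, ∑ t, f u m1 m2 v t :=
          Finset.sum_congr rfl fun _ _ => Finset.sum_congr rfl fun _ _ => Finset.sum_comm
      _ = ∑ m2, ∑ v, ∑ u, ∑ m1, ∑ t, f u m1 m2 v t :=
          Finset.sum_congr rfl fun _ _ => Finset.sum_comm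
      _ = _ := Finset.sum_congr rfl fun _ _ => Finset.sum_congr rfl fun _ _ =>
          Finset.sum_congr rfl fun _ _ => Finset.sum_comm
  rw [this]
  refine Finset.sum_congr rfl fun m2 _ => Finset.sum_congr rfl fun v _ =>
    Finset.sum_congr rfl fun u _ => ?_
  refine Finset.sum_congr rfl fun t _ => ?_
  try rw [Finset.mul_sum, Finset.mul_sum]
  refine Finset.sum_congr rfl fun m1 _ => by ring

theorem mem_BR1 (PU : U → ℝ) (d1 : U → V1 → ℝ) {n : ℕ} (hn : 1 ≤ n)
    (σ : (Fin n → U) → M1 × M2 → ℝ) (τ : M1 × M2 → (Fin n → V1) → ℝ) :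
    τ ∈ BR1 PU d1 σ ↔ IsBR PU d1 σ τ := by
  have hn' : (0 : ℝ) < (n : ℝ)⁻¹ := by positivity
  unfold BR1 IsBR
  refine and_congr_right fun hτ => ?_
  rw [← br_iff _ _ hτ]
  simp_rw [d1N_eq, mul_le_mul_iff_right₀ hn']

theorem mem_BR2 (PU : U → ℝ) (d2 : U → V2 → ℝ) {n : ℕ} (hn : 1 ≤ n)
    (σ : (Fin n → U) → M1 × M2 → ℝ) (τ : M2 → (Fin n → V2) → ℝ) :
    τ ∈ BR2 PU d2 σ ↔ IsBR PU d2 (mrg σ) τ := by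
  have hn' : (0 : ℝ) < (n : ℝ)⁻¹ := by positivity
  unfold BR2 IsBR
  refine and_congr_right fun hτ => ?_
  rw [← br_iff _ _ hτ]
  simp_rw [d2N_eq, mul_le_mul_iff_right₀ hn']

theorem exists_BR [Nonempty V] (PU : U → ℝ) (d : U → V → ℝ) {n : ℕ} (ρ : (Fin n → U) → M → ℝ) :
    ∃ τ : M → (Fin n → V) → ℝ, IsBR PU d ρ τ := by
  classical
  choose f hf using fun μ => Finite.exists_min (cst PU d ρ μ)
  refine ⟨fun μ => Pi.single (f μ) 1, fun μ => isDist_single _, fun μ v => ?_⟩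
  simpa [Pi.single_apply] using hf μ v

def mL {n m : ℕ} (p : (Fin (n + m) → V) → ℝ) (v : Fin n → V) : ℝ := ∑ v', p (Fin.append v v')
def mR {n m : ℕ} (p : (Fin (n + m) → V) → ℝ) (v' : Fin m → V) : ℝ := ∑ v, p (Fin.append v v')

theorem mL_dist {n m : ℕ} {p : (Fin (n + m) → V) → ℝ} (h : IsDist p) : IsDist (mL p) :=
  ⟨fun _ => Finset.sum_nonneg fun _ _ => h.1 _, by rw [← h.2, sum_append]; rfl⟩
theorem mR_dist {n m : ℕ} {p : (Fin (n + m) → V) → ℝ} (h : IsDist p) : IsDist (mR p) :=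
  ⟨fun _ => Finset.sum_nonneg fun _ _ => h.1 _, by rw [← h.2, sum_append, Finset.sum_comm]; rfl⟩

theorem cst_append (PU : U → ℝ) (d : U → V → ℝ) {n m : ℕ} (ρ : (Fin (n + m) → U) → M → ℝ)
    {A B : Type*} [Fintype A] [Fintype B]
    (ρn : (Fin n → U) → A → ℝ) (ρm : (Fin m → U) → B → ℝ) (μ : M) (a : A) (b : B)
    (h : ∀ x y, ρ (Fin.append x y) μ = ρn x a * ρm y b) (v : Fin n → V) (v' : Fin m → V) :
    cst PU d ρ μ (Fin.append v v') =
      prb PU ρm b * cst PU d ρn a v + prb PU ρn a * cst PU d ρm b v' := by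
  unfold cst prb
  rw [sum_append]
  simp_rw [h, Fin.prod_univ_add, Fin.sum_univ_add, Fin.append_left, Fin.append_right]
  rw [mul_comm (∑ u : Fin m → U, (∏ t, PU (u t)) * ρm u b), Finset.sum_mul_sum,
    Finset.sum_mul_sum, ← Finset.sum_add_distrib]
  refine Finset.sum_congr rfl fun x _ => ?_
  rw [← Finset.sum_add_distrib]
  refine Finset.sum_congr rfl fun y _ => by ring

theorem exp_append {n m : ℕ} (p : (Fin (n + m) → V) → ℝ) (f : (Fin n → V) → ℝ)
    (g : (Fin m → V) → ℝ) (c : (Fin (n + m) → V) → ℝ) (α β : ℝ)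
    (hc : ∀ v v', c (Fin.append v v') = α * f v + β * g v') :
    ∑ w, p w * c w = α * ∑ v, mL p v * f v + β * ∑ v', mR p v' * g v' := by
  rw [sum_append]
  simp_rw [hc, mul_add, Finset.sum_add_distrib]
  unfold mL mR
  simp_rw [Finset.sum_mul, Finset.mul_sum]
  congr 1
  · refine Finset.sum_congr rfl fun x _ => Finset.sum_congr rfl fun y _ => by ring
  · rw [Finset.sum_comm]
    refine Finset.sum_congr rfl fun x _ => Finset.sum_congr rfl fun y _ => by ring

theorem IsBR.left {PU : U → ℝ} {d : U → V → ℝ} {n m : ℕ} {ρ : (Fin (n + m) → U) → M → ℝ}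
    {τ : M → (Fin (n + m) → V) → ℝ} (hτ : IsBR PU d ρ τ)
    {A B : Type*} [Fintype A] [Fintype B]
    (ρn : (Fin n → U) → A → ℝ) (ρm : (Fin m → U) → B → ℝ) (b : B) (E : A → M)
    (h : ∀ a x y, ρ (Fin.append x y) (E a) = ρn x a * ρm y b) (hb : 0 < prb PU ρm b) :
    IsBR PU d ρn (fun a => mL (τ (E a))) := by
  refine ⟨fun a => mL_dist (hτ.1 _), fun a v => ?_⟩
  have hc := cst_append PU d ρ ρn ρm (E a) a b (h a)
  have h1 := exp_append (τ (E a)) _ _ _ _ _ hc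
  have h2 : ∀ v', prb PU ρm b * ∑ w, mL (τ (E a)) w * cst PU d ρn a w +
      prb PU ρn a * ∑ w, mR (τ (E a)) w * cst PU d ρm b w ≤
      prb PU ρm b * cst PU d ρn a v + prb PU ρn a * cst PU d ρm b v' := by
    intro v'
    rw [← h1, ← hc]; exact hτ.2 _ _
  have hR := mR_dist (hτ.1 (E a))
  have h3 := Finset.sum_le_sum fun v' (_ : v' ∈ Finset.univ) =>
    mul_le_mul_of_nonneg_left (h2 v') (hR.1 v')
  rw [← Finset.sum_mul, hR.2] at h3
  simp_rw [mul_add, Finset.sum_add_distrib] at h3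
  rw [← Finset.sum_mul, hR.2] at h3
  have h4 : ∑ w, mR (τ (E a)) w * (prb PU ρn a * cst PU d ρm b w) =
      prb PU ρn a * ∑ w, mR (τ (E a)) w * cst PU d ρm b w := by
    rw [Finset.mul_sum]; exact Finset.sum_congr rfl fun _ _ => by ring
  rw [h4] at h3
  refine le_of_mul_le_mul_left ?_ hb
  linarith

theorem IsBR.right {PU : U → ℝ} {d : U → V → ℝ} {n m : ℕ} {ρ : (Fin (n + m) → U) → M → ℝ}
    {τ : M → (Fin (n + m) → V) → ℝ} (hτ : IsBR PU d ρ τ)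
    {A B : Type*} [Fintype A] [Fintype B]
    (ρn : (Fin n → U) → A → ℝ) (ρm : (Fin m → U) → B → ℝ) (a : A) (E : B → M)
    (h : ∀ b x y, ρ (Fin.append x y) (E b) = ρn x a * ρm y b) (ha : 0 < prb PU ρn a) :
    IsBR PU d ρm (fun b => mR (τ (E b))) := by
  refine ⟨fun a => mR_dist (hτ.1 _), fun b v' => ?_⟩
  have hc := cst_append PU d ρ ρn ρm (E b) a b (h b)
  have h1 := exp_append (τ (E b)) _ _ _ _ _ hc
  have h2 : ∀ v, prb PU ρm b * ∑ w, mL (τ (E b)) w * cst PU d ρn a w +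
      prb PU ρn a * ∑ w, mR (τ (E b)) w * cst PU d ρm b w ≤
      prb PU ρm b * cst PU d ρn a v + prb PU ρn a * cst PU d ρm b v' := by
    intro v
    rw [← h1, ← hc]; exact hτ.2 _ _
  have hR := mL_dist (hτ.1 (E b))
  have h3 := Finset.sum_le_sum fun v (_ : v ∈ Finset.univ) =>
    mul_le_mul_of_nonneg_left (h2 v) (hR.1 v)
  rw [← Finset.sum_mul, hR.2] at h3
  simp_rw [mul_add, Finset.sum_add_distrib] at h3
  rw [← Finset.sum_mul _ _ (prb PU ρn a * _), hR.2] at h3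
  have h4 : ∑ w, mL (τ (E b)) w * (prb PU ρm b * cst PU d ρn a w) =
      prb PU ρm b * ∑ w, mL (τ (E b)) w * cst PU d ρn a w := by
    rw [Finset.mul_sum]; exact Finset.sum_congr rfl fun _ _ => by ring
  rw [h4] at h3
  refine le_of_mul_le_mul_left ?_ ha
  linarith

noncomputable def HH (de : U → V1 → V2 → ℝ) {n : ℕ} (p : (Fin n → V1) → ℝ) (q : (Fin n → V2) → ℝ)
    (u : Fin n → U) : ℝ := ∑ v, ∑ w, p v * q w * ∑ t, de (u t) (v t) (w t)

theorem HH_append (de : U → V1 → V2 → ℝ) {n m : ℕ} (p : (Fin (n + m) → V1) → ℝ)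
    (q : (Fin (n + m) → V2) → ℝ) (hp : IsDist p) (hq : IsDist q) (x : Fin n → U) (y : Fin m → U) :
    HH de p q (Fin.append x y) = HH de (mL p) (mL q) x + HH de (mR p) (mR q) y := by
  have key : ∀ v v', ∑ w, q w * ∑ t, de (Fin.append x y t) (Fin.append v v' t) (w t) =
      1 * (∑ w, mL q w * ∑ t, de (x t) (v t) (w t)) +
      1 * (∑ w, mR q w * ∑ t, de (y t) (v' t) (w t)) := by
    intro v v'
    refine exp_append q _ _ _ _ _ fun w w' => ?_
    simp [Fin.sum_univ_add]
  have := exp_append p _ _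
    (fun v => ∑ w, q w * ∑ t, de (Fin.append x y t) (v t) (w t)) _ _ key
  unfold HH
  simp_rw [mul_assoc, ← Finset.mul_sum]
  simpa using this

theorem deN_eq (PU : U → ℝ) (de : U → V1 → V2 → ℝ) {n : ℕ} (hn : 1 ≤ n)
    (σ : (Fin n → U) → M1 × M2 → ℝ) (τ1 : M1 × M2 → (Fin n → V1) → ℝ)
    (τ2 : M2 → (Fin n → V2) → ℝ) :
    (n : ℝ) * deN PU de σ τ1 τ2 = ∑ u : Fin n → U, (∏ t, PU (u t)) *
      ∑ μ, σ u μ * HH de (τ1 μ) (τ2 μ.2) u := by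
  have hn' : (n : ℝ) ≠ 0 := by positivity
  unfold deN HH
  simp_rw [Fintype.sum_prod_type, Finset.mul_sum]
  refine Finset.sum_congr rfl fun u _ => Finset.sum_congr rfl fun m1 _ =>
    Finset.sum_congr rfl fun m2 _ => Finset.sum_congr rfl fun v _ =>
    Finset.sum_congr rfl fun w _ => Finset.sum_congr rfl fun t _ => ?_
  field_simp

theorem IsDist.le_one {α : Type*} [Fintype α] {p : α → ℝ} (h : IsDist p) (a : α) : p a ≤ 1 := by
  rw [← h.2]; exact Finset.single_le_sum (fun b _ => h.1 b) (Finset.mem_univ a)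

noncomputable def bnd (PU : U → ℝ) (de : U → V1 → V2 → ℝ) (M1 M2 : Type*) [Fintype M1] [Fintype M2]
    (n : ℕ) : ℝ :=
  ∑ un : Fin n → U, ∑ _m1 : M1, ∑ _m2 : M2, ∑ v1n : Fin n → V1, ∑ v2n : Fin n → V2,
    |(∏ t, PU (un t)) * ((n : ℝ)⁻¹ * ∑ t, de (un t) (v1n t) (v2n t))|

theorem abs_deN_le (PU : U → ℝ) (de : U → V1 → V2 → ℝ) {n : ℕ}
    (σ : (Fin n → U) → M1 × M2 → ℝ) (τ1 : M1 × M2 → (Fin n → V1) → ℝ)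
    (τ2 : M2 → (Fin n → V2) → ℝ) (hσ : IsKernel σ) (h1 : IsKernel τ1) (h2 : IsKernel τ2) :
    |deN PU de σ τ1 τ2| ≤ bnd PU de M1 M2 n := by
  unfold deN bnd
  refine (Finset.abs_sum_le_sum_abs _ _).trans (Finset.sum_le_sum fun u _ => ?_)
  refine (Finset.abs_sum_le_sum_abs _ _).trans (Finset.sum_le_sum fun m1 _ => ?_)
  refine (Finset.abs_sum_le_sum_abs _ _).trans (Finset.sum_le_sum fun m2 _ => ?_)
  refine (Finset.abs_sum_le_sum_abs _ _).trans (Finset.sum_le_sum fun v _ => ?_)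
  refine (Finset.abs_sum_le_sum_abs _ _).trans (Finset.sum_le_sum fun w _ => ?_)
  set c := ((n : ℝ)⁻¹ * ∑ t, de (u t) (v t) (w t))
  have e : (∏ t, PU (u t)) * σ u (m1, m2) * τ1 (m1, m2) v * τ2 m2 w * c =
    (σ u (m1, m2) * τ1 (m1, m2) v * τ2 m2 w) * ((∏ t, PU (u t)) * c) := by ring
  rw [e, abs_mul]
  have a0 := (hσ u).1 (m1, m2)
  have a1 := (hσ u).le_one (m1, m2)
  have b0 := (h1 (m1, m2)).1 v
  have b1 := (h1 (m1, m2)).le_one v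
  have c0 := (h2 m2).1 w
  have c1 := (h2 m2).le_one w
  rw [abs_of_nonneg (by positivity)]
  refine mul_le_of_le_one_left (abs_nonneg _) ?_
  exact mul_le_one₀ (mul_le_one₀ a1 b0 b1) c0 c1

theorem deN_le_worst (PU : U → ℝ) (de : U → V1 → V2 → ℝ) (d1 : U → V1 → ℝ) (d2 : U → V2 → ℝ)
    {n : ℕ} (σ : (Fin n → U) → M1 × M2 → ℝ) (hσ : IsKernel σ)
    {τ1 : M1 × M2 → (Fin n → V1) → ℝ} {τ2 : M2 → (Fin n → V2) → ℝ}
    (h1 : τ1 ∈ BR1 PU d1 σ) (h2 : τ2 ∈ BR2 PU d2 σ) :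
    deN PU de σ τ1 τ2 ≤ DeWorst PU de d1 d2 σ := by
  refine le_csSup ⟨bnd PU de M1 M2 n, ?_⟩ ⟨τ1, h1, τ2, h2, rfl⟩
  rintro _ ⟨t1, k1, t2, k2, rfl⟩
  exact (le_abs_self _).trans (abs_deN_le PU de σ t1 t2 hσ k1.1 k2.1)

theorem worst_bddBelow (PU : U → ℝ) (de : U → V1 → V2 → ℝ) (d1 : U → V1 → ℝ) (d2 : U → V2 → ℝ)
    {n : ℕ} (σ : (Fin n → U) → M1 × M2 → ℝ) (hσ : IsKernel σ) :
    - bnd PU de M1 M2 n ≤ DeWorst PU de d1 d2 σ := by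
  by_cases h : ∃ τ1 ∈ BR1 PU d1 σ, ∃ τ2 ∈ BR2 PU d2 σ, True
  · obtain ⟨τ1, h1, τ2, h2, -⟩ := h
    refine le_trans ?_ (deN_le_worst PU de d1 d2 σ hσ h1 h2)
    exact (abs_le.1 (abs_deN_le PU de σ τ1 τ2 hσ h1.1 h2.1)).1
  · have : {y | ∃ τ1 ∈ BR1 PU d1 σ, ∃ τ2 ∈ BR2 PU d2 σ, y = deN PU de σ τ1 τ2} = ∅ := by
      ext y
      simp only [Set.mem_setOf_eq, Set.mem_empty_iff_false, iff_false]
      rintro ⟨τ1, h1, τ2, h2, -⟩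
      exact h ⟨τ1, h1, τ2, h2, trivial⟩
    unfold DeWorst
    rw [this, Real.sSup_empty, neg_nonpos]
    unfold bnd
    positivity

/-- the product encoder -/
noncomputable def sig {A1 A2 B1 B2 K1 K2 : Type*} [Fintype A1] [Fintype A2] [Fintype B1]
    [Fintype B2] [DecidableEq K1] [DecidableEq K2] {n m : ℕ}
    (e1 : A1 × B1 → K1) (e2 : A2 × B2 → K2)
    (σn : (Fin n → U) → A1 × A2 → ℝ) (σm : (Fin m → U) → B1 × B2 → ℝ) :
    (Fin (n + m) → U) → K1 × K2 → ℝ := fun u k =>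
  ∑ a : A1 × A2, ∑ b : B1 × B2, if (e1 (a.1, b.1), e2 (a.2, b.2)) = k then
    σn (fun i => u (Fin.castAdd m i)) a * σm (fun i => u (Fin.natAdd n i)) b else 0

section prodenc

variable {A1 A2 B1 B2 K1 K2 : Type*} [Fintype A1] [Fintype A2] [Fintype B1]
    [Fintype B2] [Fintype K1] [Fintype K2] [DecidableEq K1] [DecidableEq K2] {n m : ℕ}
    (e1 : A1 × B1 → K1) (e2 : A2 × B2 → K2)
    (σn : (Fin n → U) → A1 × A2 → ℝ) (σm : (Fin m → U) → B1 × B2 → ℝ)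

theorem sig_sum (x : Fin n → U) (y : Fin m → U) (F : K1 × K2 → ℝ) :
    ∑ k, sig e1 e2 σn σm (Fin.append x y) k * F k =
      ∑ a, ∑ b, σn x a * σm y b * F (e1 (a.1, b.1), e2 (a.2, b.2)) := by
  unfold sig
  simp_rw [Finset.sum_mul]
  rw [Finset.sum_comm]
  refine Finset.sum_congr rfl fun a _ => ?_
  rw [Finset.sum_comm]
  refine Finset.sum_congr rfl fun b _ => ?_
  simp [ite_mul]

theorem sig_kernel (hn : IsKernel σn) (hm : IsKernel σm) : IsKernel (sig e1 e2 σn σm) := by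
  intro u
  obtain ⟨⟨x, y⟩, rfl⟩ := (Fin.appendEquiv n m).surjective u
  change IsDist (sig e1 e2 σn σm (Fin.append x y))
  constructor
  · intro k
    refine Finset.sum_nonneg fun a _ => Finset.sum_nonneg fun b _ => ?_
    split_ifs
    · exact mul_nonneg ((hn _).1 _) ((hm _).1 _)
    · exact le_rfl
  · have := sig_sum e1 e2 σn σm x y (fun _ => 1)
    simp only [mul_one] at this
    rw [this, ← Finset.sum_mul_sum, (hn x).2, (hm y).2, one_mul]

theorem sig_apply (he1 : Function.Injective e1) (he2 : Function.Injective e2)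
    (x : Fin n → U) (y : Fin m → U) (a : A1 × A2) (b : B1 × B2) :
    sig e1 e2 σn σm (Fin.append x y) (e1 (a.1, b.1), e2 (a.2, b.2)) = σn x a * σm y b := by
  unfold sig
  rw [Finset.sum_eq_single a, Finset.sum_eq_single b]
  · simp
  · intro b' _ hb
    rw [if_neg]
    intro h
    simp only [Prod.mk.injEq, he1.eq_iff, he2.eq_iff] at h
    exact hb (Prod.ext h.1.2 h.2.2)
  · simp
  · intro a' _ ha
    refine Finset.sum_eq_zero fun b' _ => ?_
    rw [if_neg]
    intro h
    simp only [Prod.mk.injEq, he1.eq_iff, he2.eq_iff] at h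
    exact ha (Prod.ext h.1.1 h.2.1)
  · simp

theorem sig_mrg (he2 : Function.Injective e2)
    (x : Fin n → U) (y : Fin m → U) (a : A2) (b : B2) :
    mrg (sig e1 e2 σn σm) (Fin.append x y) (e2 (a, b)) = mrg σn x a * mrg σm y b := by
  have := sig_sum e1 e2 σn σm x y (fun k => if k.2 = e2 (a, b) then 1 else 0)
  simp only [Fintype.sum_prod_type, he2.eq_iff, Prod.mk.injEq, mul_ite, mul_one, mul_zero,
    Finset.sum_ite_eq', Finset.mem_univ, if_true] at this
  unfold mrg
  rw [this, Finset.sum_mul_sum]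
  refine Finset.sum_congr rfl fun a1 _ => ?_
  refine (Finset.sum_eq_single a ?_ ?_).trans ?_
  · intro a' _ h
    refine Finset.sum_eq_zero fun b1 _ => Finset.sum_eq_zero fun b2 _ => ?_
    rw [if_neg (fun hh => h (Prod.mk.inj (he2 hh)).1)]
  · intro h; exact absurd (Finset.mem_univ a) h
  · refine Finset.sum_congr rfl fun b1 _ => ?_
    refine (Finset.sum_eq_single b ?_ ?_).trans ?_
    · intro b' _ h
      rw [if_neg (fun hh => h (Prod.mk.inj (he2 hh)).2)]
    · intro h; exact absurd (Finset.mem_univ b) h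
    · rw [if_pos rfl]

theorem prb_nonneg {M : Type*} [Fintype M] {PU : U → ℝ} (hPU : IsDist PU) {n : ℕ}
    {ρ : (Fin n → U) → M → ℝ} (hρ : IsKernel ρ) (μ : M) : 0 ≤ prb PU ρ μ :=
  Finset.sum_nonneg fun u _ => mul_nonneg (prodPU_nonneg hPU u) ((hρ u).1 μ)

theorem prb_sum {M : Type*} [Fintype M] {PU : U → ℝ} (hPU : IsDist PU) {n : ℕ}
    {ρ : (Fin n → U) → M → ℝ} (hρ : IsKernel ρ) : ∑ μ, prb PU ρ μ = 1 := by
  unfold prb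
  rw [Finset.sum_comm]
  simp_rw [← Finset.mul_sum, (hρ _).2, mul_one]
  exact sum_prodPU hPU n

theorem prb_mrg {M1 M2 : Type*} [Fintype M1] [Fintype M2] {PU : U → ℝ} (hPU : IsDist PU) {n : ℕ}
    {σ : (Fin n → U) → M1 × M2 → ℝ} (hσ : IsKernel σ) (μ : M1 × M2) :
    prb PU σ μ ≤ prb PU (mrg σ) μ.2 := by
  refine Finset.sum_le_sum fun u _ => mul_le_mul_of_nonneg_left ?_ (prodPU_nonneg hPU u)
  exact Finset.single_le_sum (f := fun m1 => σ u (m1, μ.2)) (fun m1 _ => (hσ u).1 _)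
    (Finset.mem_univ μ.1)

theorem deN_sig (PU : U → ℝ) (de : U → V1 → V2 → ℝ) (hn : 1 ≤ n) (hm : 1 ≤ m)
    (τ1 : K1 × K2 → (Fin (n + m) → V1) → ℝ) (τ2 : K2 → (Fin (n + m) → V2) → ℝ)
    (h1 : IsKernel τ1) (h2 : IsKernel τ2) :
    ((n + m : ℕ) : ℝ) * deN PU de (sig e1 e2 σn σm) τ1 τ2 =
      (∑ b, prb PU σm b * ((n : ℝ) * deN PU de σn
        (fun a => mL (τ1 (e1 (a.1, b.1), e2 (a.2, b.2)))) (fun a2 => mL (τ2 (e2 (a2, b.2)))))) +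
      ∑ a, prb PU σn a * ((m : ℝ) * deN PU de σm
        (fun b => mR (τ1 (e1 (a.1, b.1), e2 (a.2, b.2)))) (fun b2 => mR (τ2 (e2 (a.2, b2))))) := by
  rw [deN_eq PU de (by omega)]
  simp_rw [deN_eq PU de hn, deN_eq PU de hm]
  rw [sum_append]
  simp_rw [sig_sum, HH_append de _ _ (h1 _) (h2 _), Fin.prod_univ_add, Fin.append_left,
    Fin.append_right]
  unfold prb
  simp_rw [mul_add, Finset.sum_add_distrib, mul_add, Finset.sum_add_distrib]
  congr 1
  · simp_rw [Finset.sum_mul, Finset.mul_sum]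
    have : ∀ f : (Fin n → U) → (Fin m → U) → A1 × A2 → B1 × B2 → ℝ,
        ∑ x, ∑ y, ∑ a, ∑ b, f x y a b = ∑ b, ∑ y, ∑ x, ∑ a, f x y a b := by
      intro f
      calc _ = ∑ x, ∑ y, ∑ b, ∑ a, f x y a b :=
            Finset.sum_congr rfl fun _ _ => Finset.sum_congr rfl fun _ _ => Finset.sum_comm
        _ = ∑ y, ∑ x, ∑ b, ∑ a, f x y a b := Finset.sum_comm
        _ = ∑ y, ∑ b, ∑ x, ∑ a, f x y a b := Finset.sum_congr rfl fun _ _ => Finset.sum_comm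
        _ = _ := Finset.sum_comm
    rw [this]
    refine Finset.sum_congr rfl fun _ _ => Finset.sum_congr rfl fun _ _ =>
      Finset.sum_congr rfl fun _ _ => Finset.sum_congr rfl fun _ _ => by ring
  · simp_rw [Finset.sum_mul, Finset.mul_sum]
    have : ∀ f : (Fin n → U) → (Fin m → U) → A1 × A2 → B1 × B2 → ℝ,
        ∑ x, ∑ y, ∑ a, ∑ b, f x y a b = ∑ a, ∑ x, ∑ y, ∑ b, f x y a b := by
      intro f
      calc _ = ∑ x, ∑ a, ∑ y, ∑ b, f x y a b :=
            Finset.sum_congr rfl fun _ _ => Finset.sum_comm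
        _ = _ := Finset.sum_comm
    rw [this]
    refine Finset.sum_congr rfl fun _ _ => Finset.sum_congr rfl fun _ _ =>
      Finset.sum_congr rfl fun _ _ => Finset.sum_congr rfl fun _ _ => by ring

theorem worst_sig {PU : U → ℝ} (hPU : IsDist PU) (de : U → V1 → V2 → ℝ) (d1 : U → V1 → ℝ)
    (d2 : U → V2 → ℝ) [Nonempty V1] [Nonempty V2] (hn : 1 ≤ n) (hm : 1 ≤ m)
    (he1 : Function.Injective e1) (he2 : Function.Injective e2)
    (hσn : IsKernel σn) (hσm : IsKernel σm) :
    ((n + m : ℕ) : ℝ) * DeWorst PU de d1 d2 (sig e1 e2 σn σm) ≤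
      (n : ℝ) * DeWorst PU de d1 d2 σn + (m : ℝ) * DeWorst PU de d1 d2 σm := by
  have hpos : (0 : ℝ) < ((n + m : ℕ) : ℝ) := by exact_mod_cast (by omega : 0 < n + m)
  rw [← le_div_iff₀' hpos]
  unfold DeWorst
  obtain ⟨t1, ht1⟩ := exists_BR PU d1 (sig e1 e2 σn σm)
  obtain ⟨t2, ht2⟩ := exists_BR PU d2 (mrg (sig e1 e2 σn σm))
  refine csSup_le ⟨_, t1, (mem_BR1 _ _ (by omega) _ _).2 ht1, t2,
    (mem_BR2 _ _ (by omega) _ _).2 ht2, rfl⟩ ?_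
  rintro _ ⟨τ1, h1, τ2, h2, rfl⟩
  rw [mem_BR1 _ _ (by omega)] at h1
  rw [mem_BR2 _ _ (by omega)] at h2
  rw [le_div_iff₀' hpos, deN_sig e1 e2 σn σm PU de hn hm τ1 τ2 h1.1 h2.1]
  change _ ≤ (n : ℝ) * DeWorst PU de d1 d2 σn + (m : ℝ) * DeWorst PU de d1 d2 σm
  refine add_le_add ?_ ?_
  · rw [← one_mul ((n : ℝ) * DeWorst PU de d1 d2 σn), ← prb_sum hPU hσm, Finset.sum_mul]
    refine Finset.sum_le_sum fun b _ => ?_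
    rcases (prb_nonneg hPU hσm b).eq_or_lt with h0 | h0
    · rw [← h0]; simp
    refine mul_le_mul_of_nonneg_left (mul_le_mul_of_nonneg_left ?_ (by positivity)) h0.le
    refine deN_le_worst PU de d1 d2 σn hσn ((mem_BR1 _ _ hn _ _).2 ?_) ((mem_BR2 _ _ hn _ _).2 ?_)
    · exact h1.left σn σm b (fun a => (e1 (a.1, b.1), e2 (a.2, b.2)))
        (fun a x y => sig_apply e1 e2 σn σm he1 he2 x y a b) h0
    · exact h2.left (mrg σn) (mrg σm) b.2 (fun a2 => e2 (a2, b.2))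
        (fun a x y => sig_mrg e1 e2 σn σm he2 x y a b.2) (h0.trans_le (prb_mrg hPU hσm b))
  · rw [← one_mul ((m : ℝ) * DeWorst PU de d1 d2 σm), ← prb_sum hPU hσn, Finset.sum_mul]
    refine Finset.sum_le_sum fun a _ => ?_
    rcases (prb_nonneg hPU hσn a).eq_or_lt with h0 | h0
    · rw [← h0]; simp
    refine mul_le_mul_of_nonneg_left (mul_le_mul_of_nonneg_left ?_ (by positivity)) h0.le
    refine deN_le_worst PU de d1 d2 σm hσm ((mem_BR1 _ _ hm _ _).2 ?_) ((mem_BR2 _ _ hm _ _).2 ?_)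
    · exact h1.right σn σm a (fun b => (e1 (a.1, b.1), e2 (a.2, b.2)))
        (fun b x y => sig_apply e1 e2 σn σm he1 he2 x y a b) h0
    · exact h2.right (mrg σn) (mrg σm) a.2 (fun b2 => e2 (a.2, b2))
        (fun b x y => sig_mrg e1 e2 σn σm he2 x y a.2 b) (h0.trans_le (prb_mrg hPU hσn a))

end prodenc

theorem Dn_of_empty (PU : U → ℝ) (de : U → V1 → V2 → ℝ) (d1 : U → V1 → ℝ) (d2 : U → V2 → ℝ)
    (R1 R2 : ℝ) {n : ℕ} (hn : 1 ≤ n) (h : IsEmpty V1 ∨ IsEmpty V2) :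
    Dn PU de d1 d2 R1 R2 n = 0 := by
  have hw : ∀ σ : (Fin n → U) → Msg R1 n × Msg R2 n → ℝ, DeWorst PU de d1 d2 σ = 0 := by
    intro σ
    unfold DeWorst
    convert Real.sSup_empty
    ext y
    simp only [Set.mem_setOf_eq, Set.mem_empty_iff_false, iff_false]
    rintro ⟨τ1, h1, τ2, h2, -⟩
    have : Nonempty (Fin n) := ⟨⟨0, hn⟩⟩
    have m1 : Msg R1 n := ⟨0, by positivity⟩
    have m2 : Msg R2 n := ⟨0, by positivity⟩
    rcases h with h | h
    · have := (h1.1 (m1, m2)).2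
      simp at this
    · have := (h2.1 m2).2
      simp at this
  unfold Dn
  simp_rw [hw]
  by_cases hs : ∃ σ : (Fin n → U) → Msg R1 n × Msg R2 n → ℝ, IsKernel σ
  · obtain ⟨σ, hσ⟩ := hs
    have : {x : ℝ | ∃ σ : (Fin n → U) → Msg R1 n × Msg R2 n → ℝ, IsKernel σ ∧ x = 0} = {0} := by
      ext x
      simp only [Set.mem_setOf_eq, Set.mem_singleton_iff]
      exact ⟨fun ⟨_, _, h⟩ => h, fun h => ⟨σ, hσ, h⟩⟩
    rw [this, csInf_singleton]
  · have : {x : ℝ | ∃ σ : (Fin n → U) → Msg R1 n × Msg R2 n → ℝ, IsKernel σ ∧ x = 0} = ∅ := by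
      ext x
      simp only [Set.mem_setOf_eq, Set.mem_empty_iff_false, iff_false]
      exact fun ⟨s, hs', _⟩ => hs ⟨s, hs'⟩
    rw [this, Real.sInf_empty]

theorem exists_emb (R : ℝ) (hR : 0 ≤ R) (n m : ℕ) :
    ∃ e : Msg R n × Msg R m → Msg R (n + m), Function.Injective e := by
  have h : Fintype.card (Msg R n × Msg R m) ≤ Fintype.card (Msg R (n + m)) := by
    simp only [Fintype.card_prod, Fintype.card_fin]
    rw [← pow_add]
    refine Nat.pow_le_pow_right (by norm_num) (Nat.le_floor ?_)
    push_cast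
    have a := Nat.floor_le (mul_nonneg (Nat.cast_nonneg n) hR)
    have b := Nat.floor_le (mul_nonneg (Nat.cast_nonneg m) hR)
    linarith
  obtain ⟨e⟩ := Function.Embedding.nonempty_of_card_le h
  exact ⟨e, e.injective⟩

theorem Dn_nonempty (PU : U → ℝ) (de : U → V1 → V2 → ℝ) (d1 : U → V1 → ℝ) (d2 : U → V2 → ℝ)
    (R1 R2 : ℝ) (n : ℕ) :
    {x | ∃ σ : (Fin n → U) → Msg R1 n × Msg R2 n → ℝ, IsKernel σ ∧
      x = DeWorst PU de d1 d2 σ}.Nonempty :=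
  ⟨_, fun _ => Pi.single (⟨0, by positivity⟩, ⟨0, by positivity⟩) 1,
    fun _ => isDist_single _, rfl⟩

end Helpers

/-- the sequence `n ↦ n · D_e^n(R1,R2)` is sub-additive. -/
theorem stmt0_subadditive
    {U V1 V2 : Type*} [Fintype U] [Fintype V1] [Fintype V2]
    (PU : U → ℝ) (hPU : IsDist PU)
    (de : U → V1 → V2 → ℝ) (d1 : U → V1 → ℝ) (d2 : U → V2 → ℝ)
    (R1 R2 : ℝ) (hR1 : 0 ≤ R1) (hR2 : 0 ≤ R2)
    (n m : ℕ) (hn : 1 ≤ n) (hm : 1 ≤ m) :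
    ((n + m : ℕ) : ℝ) * Dn PU de d1 d2 R1 R2 (n + m) ≤
      (n : ℝ) * Dn PU de d1 d2 R1 R2 n + (m : ℝ) * Dn PU de d1 d2 R1 R2 m := by
  by_cases hV : IsEmpty V1 ∨ IsEmpty V2
  · rw [Dn_of_empty PU de d1 d2 R1 R2 hn hV, Dn_of_empty PU de d1 d2 R1 R2 hm hV,
      Dn_of_empty PU de d1 d2 R1 R2 (by omega) hV]
    simp
  · simp only [not_or, not_isEmpty_iff] at hV
    obtain ⟨hV1, hV2⟩ := hV
    obtain ⟨e1, he1⟩ := exists_emb R1 hR1 n m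
    obtain ⟨e2, he2⟩ := exists_emb R2 hR2 n m
    have hn0 : (0 : ℝ) < n := by exact_mod_cast hn
    have hm0 : (0 : ℝ) < m := by exact_mod_cast hm
    have key : ∀ (σn : (Fin n → U) → Msg R1 n × Msg R2 n → ℝ)
        (σm : (Fin m → U) → Msg R1 m × Msg R2 m → ℝ), IsKernel σn → IsKernel σm →
        ((n + m : ℕ) : ℝ) * Dn PU de d1 d2 R1 R2 (n + m) ≤
          (n : ℝ) * DeWorst PU de d1 d2 σn + (m : ℝ) * DeWorst PU de d1 d2 σm := by
      intro σn σm hσn hσm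
      refine le_trans (mul_le_mul_of_nonneg_left ?_ (Nat.cast_nonneg _))
        (worst_sig e1 e2 σn σm hPU de d1 d2 hn hm he1 he2 hσn hσm)
      refine csInf_le ⟨-bnd PU de (Msg R1 (n + m)) (Msg R2 (n + m)) (n + m), ?_⟩
        ⟨_, sig_kernel e1 e2 σn σm hσn hσm, rfl⟩
      rintro _ ⟨σ, hσ, rfl⟩
      exact worst_bddBelow PU de d1 d2 σ hσ
    set L := ((n + m : ℕ) : ℝ) * Dn PU de d1 d2 R1 R2 (n + m)
    have k1 : ∀ σm : (Fin m → U) → Msg R1 m × Msg R2 m → ℝ, IsKernel σm →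
        L ≤ (n : ℝ) * Dn PU de d1 d2 R1 R2 n + (m : ℝ) * DeWorst PU de d1 d2 σm := by
      intro σm hσm
      have : (L - (m : ℝ) * DeWorst PU de d1 d2 σm) / n ≤ Dn PU de d1 d2 R1 R2 n := by
        refine le_csInf (Dn_nonempty PU de d1 d2 R1 R2 n) ?_
        rintro _ ⟨σn, hσn, rfl⟩
        rw [div_le_iff₀' hn0]
        linarith [key σn σm hσn hσm]
      rw [div_le_iff₀' hn0] at this
      linarith
    have : (L - (n : ℝ) * Dn PU de d1 d2 R1 R2 n) / m ≤ Dn PU de d1 d2 R1 R2 m := by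
      refine le_csInf (Dn_nonempty PU de d1 d2 R1 R2 m) ?_
      rintro _ ⟨σm, hσm, rfl⟩
      rw [div_le_iff₀' hm0]
      linarith [k1 σm hσm]
    rw [div_le_iff₀' hm0] at this
    linarith

end Persuasion
end

section
/- Converse part of the main theorem: for all rates R1, R2 ≥ 0 and every blocklength n ≥ 1, D_e^n(R1,R2) ≥ D_e*(R1,R2). -/
open scoped BigOperators

namespace Persuasion

open Classical in
noncomputable def JJ {U W M : Type*} [Fintype U] [Fintype M] {n : ℕ}
    (p : (Fin n → U) → M → ℝ) (f : Fin n → M → W) (z : U × W) : ℝ :=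
  (n : ℝ)⁻¹ * ∑ x : Fin n × (Fin n → U) × M,
    if (x.2.1 x.1, f x.1 x.2.2) = z then p x.2.1 x.2.2 else 0

lemma JJ_sum {U W M : Type*} [Fintype U] [Fintype W] [Fintype M] {n : ℕ}
    (p : (Fin n → U) → M → ℝ) (f : Fin n → M → W) (g : U × W → ℝ) :
    ∑ z, JJ p f z * g z =
      (n : ℝ)⁻¹ * ∑ t, ∑ un, ∑ m, p un m * g (un t, f t m) := by
  classical
  simp only [JJ, mul_assoc, Finset.sum_mul]
  rw [← Finset.mul_sum, Finset.sum_comm]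
  simp only [ite_mul, zero_mul]
  simp only [Fintype.sum_prod_type (α₁ := Fin n), Fintype.sum_prod_type (α₁ := Fin n → U)]
  simp

lemma JJ_nonneg {U W M : Type*} [Fintype U] [Fintype M] {n : ℕ}
    (p : (Fin n → U) → M → ℝ) (hp : ∀ un m, 0 ≤ p un m) (f : Fin n → M → W) (z : U × W) :
    0 ≤ JJ p f z := by
  classical
  unfold JJ
  refine mul_nonneg (by positivity) (Finset.sum_nonneg fun x _ => ?_)
  split_ifs
  · exact hp _ _
  · exact le_rfl

lemma JJ_pos {U W M : Type*} [Fintype U] [Fintype M] {n : ℕ} (hn : 1 ≤ n)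
    (p : (Fin n → U) → M → ℝ) (hp : ∀ un m, 0 ≤ p un m) (f : Fin n → M → W)
    (t : Fin n) (un : Fin n → U) (m : M) (h : 0 < p un m) :
    0 < JJ p f (un t, f t m) := by
  classical
  unfold JJ
  have hn' : (0:ℝ) < n := by exact_mod_cast hn
  refine mul_pos (by positivity) ?_
  refine lt_of_lt_of_le h ?_
  have := Finset.single_le_sum (s := Finset.univ)
    (f := fun x : Fin n × (Fin n → U) × M =>
      if (x.2.1 x.1, f x.1 x.2.2) = (un t, f t m) then p x.2.1 x.2.2 else 0)
    (fun x _ => by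
      split_ifs
      · exact hp _ _
      · exact le_rfl) (Finset.mem_univ (t, un, m))
  simpa using this

lemma prod_marg {V : Type*} [Fintype V] {n : ℕ} (κ : Fin n → V → ℝ)
    (hκ : ∀ t, ∑ v, κ t v = 1) (t0 : Fin n) (F : V → ℝ) :
    ∑ vn : Fin n → V, (∏ t, κ t (vn t)) * F (vn t0) = ∑ v, κ t0 v * F v := by
  classical
  have h := Finset.prod_univ_sum (fun _ : Fin n => (Finset.univ : Finset V))
    (fun i v => κ i v * if i = t0 then F v else 1)
  rw [Fintype.piFinset_univ] at h
  have h2 : ∀ vn : Fin n → V, ∏ i, (κ i (vn i) * if i = t0 then F (vn i) else 1) =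
      (∏ t, κ t (vn t)) * F (vn t0) := by
    intro vn
    rw [Finset.prod_mul_distrib]
    simp
  rw [← Finset.sum_congr rfl fun vn _ => h2 vn, ← h]
  rw [Finset.prod_eq_single t0]
  · simp
  · intro b _ hb
    simp [hb, hκ]
  · simp

lemma prod_kernel {V M : Type*} [Fintype V] {n : ℕ} (k : Fin n → M → V → ℝ)
    (hk : ∀ t, IsKernel (k t)) :
    IsKernel (fun m (vn : Fin n → V) => ∏ t, k t m (vn t)) := by
  classical
  intro m
  refine ⟨fun vn => Finset.prod_nonneg fun t _ => (hk t m).1 _, ?_⟩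
  have h := Finset.prod_univ_sum (fun _ : Fin n => (Finset.univ : Finset V)) (fun t v => k t m v)
  rw [Fintype.piFinset_univ] at h
  rw [← h]
  exact Finset.prod_eq_one fun t _ => (hk t m).2

lemma JJ_marg {U W M : Type*} [Fintype U] [Fintype W] [Fintype M] {n : ℕ} (hn : 1 ≤ n)
    (PU : U → ℝ) (hPU : IsDist PU) (s : (Fin n → U) → M → ℝ) (hs : IsKernel s)
    (f : Fin n → M → W) (u : U) :
    ∑ w, JJ (fun un m => (∏ t, PU (un t)) * s un m) f (u, w) = PU u := by
  classical
  have h := JJ_sum (fun un m => (∏ t, PU (un t)) * s un m) f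
    (fun z => if z.1 = u then 1 else 0)
  rw [Fintype.sum_prod_type_right] at h
  simp only [mul_ite, mul_one, mul_zero, Finset.sum_ite_eq', Finset.sum_ite_eq,
    Finset.mem_univ, if_true] at h
  rw [h]
  have h2 : ∀ t : Fin n, ∑ un : Fin n → U, ∑ m, (if un t = u then (∏ t, PU (un t)) * s un m else 0)
      = PU u := by
    intro t
    have := prod_marg (fun _ : Fin n => PU) (fun _ => hPU.2) t (fun v => if v = u then 1 else 0)
    simp only [mul_ite, mul_one, mul_zero, Finset.sum_ite_eq', Finset.mem_univ, if_true] at this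
    rw [← this]
    refine Finset.sum_congr rfl fun un _ => ?_
    split_ifs
    · rw [← Finset.mul_sum, (hs un).2, mul_one]
    · simp
  simp only [h2]
  have hn' : (n:ℝ) ≠ 0 := by positivity
  simp [hn']

lemma mi_eq {α β : Type*} [Fintype α] [Fintype β] (p : α × β → ℝ) :
    miOfJoint p = ∑ z, p z * (Real.logb 2 (p z) - Real.logb 2 (∑ b, p (z.1, b))
      - Real.logb 2 (∑ a, p (a, z.2))) := by
  unfold miOfJoint ent
  simp only [mul_sub, Finset.sum_sub_distrib]
  have h1 : ∑ z : α × β, p z * Real.logb 2 (∑ b, p (z.1, b)) =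
      ∑ a, (∑ b, p (a, b)) * Real.logb 2 (∑ b, p (a, b)) := by
    rw [Fintype.sum_prod_type]
    simp only [Finset.sum_mul]
  have h2 : ∑ z : α × β, p z * Real.logb 2 (∑ a, p (a, z.2)) =
      ∑ b, (∑ a, p (a, b)) * Real.logb 2 (∑ a, p (a, b)) := by
    rw [Fintype.sum_prod_type_right]
    simp only [Finset.sum_mul]
  rw [h1, h2]
  ring

lemma info {U W M : Type*} [Fintype U] [Fintype W] [Fintype M] {n : ℕ} (hn : 1 ≤ n)
    (PU : U → ℝ) (hPU : IsDist PU) (s : (Fin n → U) → M → ℝ) (hs : IsKernel s)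
    (f : Fin n → M → W) (hM : 0 < Fintype.card M) :
    (n : ℝ) * miOfJoint (JJ (fun un m => (∏ t, PU (un t)) * s un m) f)
      ≤ Real.logb 2 (Fintype.card M) := by
  classical
  have hn' : (n:ℝ) ≠ 0 := by positivity
  set P : (Fin n → U) → ℝ := fun un => ∏ t, PU (un t) with hP
  have hP0 : ∀ un, 0 ≤ P un := fun un => Finset.prod_nonneg fun t _ => hPU.1 _
  set p : (Fin n → U) → M → ℝ := fun un m => P un * s un m with hpdef
  have hp0 : ∀ un m, 0 ≤ p un m := fun un m => mul_nonneg (hP0 un) ((hs un).1 m)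
  set j := JJ p f with hj
  have hj0 : ∀ z, 0 ≤ j z := JJ_nonneg p hp0 f
  have hjU : ∀ u, ∑ w, j (u, w) = PU u := fun u => JJ_marg hn PU hPU s hs f u
  set jW : W → ℝ := fun w => ∑ u, j (u, w) with hjW
  set c : ℝ := (Fintype.card M : ℝ) with hc
  have hc0 : 0 < c := by rw [hc]; exact_mod_cast hM
  rw [mi_eq]
  simp only [hjU]
  rw [hj, JJ_sum, ← mul_assoc, mul_inv_cancel₀ hn', one_mul, ← hj]
  set r : (Fin n → U) → M → ℝ := fun un m => ∏ t, (j (un t, f t m) / jW (f t m)) with hr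
  have hjW0 : ∀ w, 0 ≤ jW w := fun w => Finset.sum_nonneg fun u _ => hj0 _
  have hr0 : ∀ un m, 0 ≤ r un m := fun un m =>
    Finset.prod_nonneg fun t _ => div_nonneg (hj0 _) (hjW0 _)
  have hrsum : ∀ m, ∑ un, r un m ≤ 1 := by
    intro m
    have h := Finset.prod_univ_sum (fun _ : Fin n => (Finset.univ : Finset U))
      (fun t u => j (u, f t m) / jW (f t m))
    rw [Fintype.piFinset_univ] at h
    rw [← h]
    refine Finset.prod_le_one (fun t _ => Finset.sum_nonneg fun u _ =>
      div_nonneg (hj0 _) (hjW0 _)) fun t _ => ?_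
    rw [← Finset.sum_div]
    exact div_self_le_one _
  have hl2 : 0 < Real.log 2 := Real.log_pos (by norm_num)
  have hptsum : ∑ un, ∑ m, p un m = 1 := by
    have h1 : ∀ un, ∑ m, p un m = P un := fun un => by
      rw [hpdef]; simp only; rw [← Finset.mul_sum, (hs un).2, mul_one]
    simp only [h1]
    have h := Finset.prod_univ_sum (fun _ : Fin n => (Finset.univ : Finset U)) (fun t u => PU u)
    rw [Fintype.piFinset_univ] at h
    rw [hP, ← h]
    exact Finset.prod_eq_one fun t _ => hPU.2
  have key : ∀ un m, ∑ t, p un m * (Real.logb 2 (j (un t, f t m)) - Real.logb 2 (PU (un t))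
      - Real.logb 2 (jW (f t m))) ≤
      (r un m / c - p un m) / Real.log 2 + p un m * Real.logb 2 c := by
    intro un m
    rcases (hp0 un m).eq_or_lt with h0 | hpos
    · rw [← h0]
      simp only [zero_mul, Finset.sum_const_zero, sub_zero, add_zero]
      have := hr0 un m
      positivity
    · have hPpos : 0 < P un := by
        rcases (hP0 un).eq_or_lt with h | h
        · exfalso; rw [hpdef] at hpos; simp only [← h, zero_mul] at hpos; exact lt_irrefl _ hpos
        · exact h
      have hPUne : ∀ t, PU (un t) ≠ 0 := fun t =>
        (Finset.prod_ne_zero_iff.mp hPpos.ne') t (Finset.mem_univ t)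
      have hjpos : ∀ t, 0 < j (un t, f t m) := fun t => JJ_pos hn p hp0 f t un m hpos
      have hjWpos : ∀ t, 0 < jW (f t m) := fun t => lt_of_lt_of_le (hjpos t)
        (Finset.single_le_sum (f := fun u => j (u, f t m)) (fun u _ => hj0 _) (Finset.mem_univ (un t)))
      have hrpos : 0 < r un m := Finset.prod_pos fun t _ => div_pos (hjpos t) (hjWpos t)
      have hsum : ∑ t, (Real.logb 2 (j (un t, f t m)) - Real.logb 2 (PU (un t))
          - Real.logb 2 (jW (f t m))) = Real.logb 2 (r un m) - Real.logb 2 (P un) := by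
        rw [hr, hP]
        simp only
        rw [Real.logb_prod _ _ (fun t _ => (div_pos (hjpos t) (hjWpos t)).ne'),
          Real.logb_prod _ _ (fun t _ => hPUne t), ← Finset.sum_sub_distrib]
        refine Finset.sum_congr rfl fun t _ => ?_
        rw [Real.logb_div (hjpos t).ne' (hjWpos t).ne']
        ring
      rw [← Finset.mul_sum, hsum]
      have hx : 0 < r un m / (c * P un) := by positivity
      have hlog := Real.log_le_sub_one_of_pos hx
      rw [Real.log_div hrpos.ne' (by positivity), Real.log_mul hc0.ne' hPpos.ne'] at hlog
      have hs1 : s un m ≤ 1 := by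
        rw [← (hs un).2]
        exact Finset.single_le_sum (fun m _ => (hs un).1 m) (Finset.mem_univ m)
      have h3 : p un m * (r un m / (c * P un)) ≤ r un m / c := by
        have : p un m * (r un m / (c * P un)) = s un m * (r un m / c) := by
          rw [hpdef]; field_simp
        rw [this]
        exact mul_le_of_le_one_left (by positivity) hs1
      have h4 : p un m * (Real.log (r un m) - Real.log (P un)) ≤
          (r un m / c - p un m) + p un m * Real.log c := by
        nlinarith [mul_le_mul_of_nonneg_left hlog hpos.le]
      simp only [Real.logb]
      have h5 := div_le_div_of_nonneg_right h4 hl2.le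
      calc _ = p un m * (Real.log (r un m) - Real.log (P un)) / Real.log 2 := by ring
        _ ≤ _ := h5
        _ = _ := by ring
  calc _ = ∑ un, ∑ m, ∑ t, p un m * (Real.logb 2 (j (un t, f t m)) - Real.logb 2 (PU (un t))
      - Real.logb 2 (jW (f t m))) := by
        rw [Finset.sum_comm]
        refine Finset.sum_congr rfl fun un _ => ?_
        rw [Finset.sum_comm]
    _ ≤ ∑ un, ∑ m, ((r un m / c - p un m) / Real.log 2 + p un m * Real.logb 2 c) :=
        Finset.sum_le_sum fun un _ => Finset.sum_le_sum fun m _ => key un m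
    _ = ((∑ un, ∑ m, r un m) / c - 1) / Real.log 2 + Real.logb 2 c := by
        simp only [Finset.sum_add_distrib, ← Finset.sum_div, Finset.sum_sub_distrib,
          ← Finset.sum_mul, hptsum, one_mul]
    _ ≤ _ := by
        have h6 : ∑ un, ∑ m, r un m ≤ c := by
          rw [Finset.sum_comm]
          calc _ ≤ ∑ m : M, (1:ℝ) := Finset.sum_le_sum fun m _ => hrsum m
            _ = c := by simp [hc]
        have h7 : (∑ un, ∑ m, r un m) / c - 1 ≤ 0 := by
          rw [sub_nonpos]; exact (div_le_one hc0).mpr h6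
        have := div_nonpos_of_nonpos_of_nonneg h7 hl2.le
        linarith

/-- Generic single-letter and block distortions. -/
noncomputable def ES {U W V : Type*} [Fintype U] [Fintype W] [Fintype V]
    (j : U × W → ℝ) (d : U → V → ℝ) (k : W → V → ℝ) : ℝ :=
  ∑ u, ∑ w, ∑ v, j (u, w) * k w v * d u v

noncomputable def DB {U M V : Type*} [Fintype U] [Fintype M] [Fintype V] {n : ℕ}
    (p : (Fin n → U) → M → ℝ) (d : U → V → ℝ) (τ : M → (Fin n → V) → ℝ) : ℝ :=
  ∑ un, ∑ m, ∑ vn, p un m * τ m vn * ((n : ℝ)⁻¹ * ∑ t, d (un t) (vn t))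

lemma ES_JJ {U W M V : Type*} [Fintype U] [Fintype W] [Fintype M] [Fintype V] {n : ℕ}
    (p : (Fin n → U) → M → ℝ) (f : Fin n → M → W) (d : U → V → ℝ) (k : W → V → ℝ) :
    ES (JJ p f) d k = (n : ℝ)⁻¹ * ∑ t, ∑ un, ∑ m, p un m * ∑ v, k (f t m) v * d (un t) v := by
  have := JJ_sum p f (fun z => ∑ v, k z.2 v * d z.1 v)
  rw [← this, ES, Fintype.sum_prod_type]
  simp only [Finset.mul_sum, mul_assoc]

lemma ES_eq_DB {U W M V : Type*} [Fintype U] [Fintype W] [Fintype M] [Fintype V] {n : ℕ}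
    (p : (Fin n → U) → M → ℝ) (f : Fin n → M → W) (d : U → V → ℝ) (k : W → V → ℝ)
    (hk : IsKernel k) :
    DB p d (fun m vn => ∏ t, k (f t m) (vn t)) = ES (JJ p f) d k := by
  rw [ES_JJ, DB, Finset.sum_comm, Finset.mul_sum]
  have h : ∀ un m, ∑ vn : Fin n → V, p un m * (∏ t, k (f t m) (vn t)) *
      ((n : ℝ)⁻¹ * ∑ t, d (un t) (vn t)) =
      ∑ t, (n : ℝ)⁻¹ * (p un m * ∑ v, k (f t m) v * d (un t) v) := by
    intro un m
    simp only [← prod_marg (fun t => k (f t m)) (fun t => (hk _).2) _ (fun v => d (un _) v)]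
    simp only [Finset.mul_sum]
    rw [Finset.sum_comm]
    refine Finset.sum_congr rfl fun _ _ => Finset.sum_congr rfl fun _ _ => ?_
    ring
  simp only [h, Finset.mul_sum (s := (Finset.univ : Finset (Fin n → U))),
    Finset.mul_sum (s := (Finset.univ : Finset M))]
  rw [Finset.sum_comm]
  simp only [Finset.sum_comm (s := (Finset.univ : Finset M)) (t := (Finset.univ : Finset (Fin n)))]
  rw [Finset.sum_comm]

open Classical in
noncomputable def kdet {W V : Type*} (b : W → V) (w : W) (v : V) : ℝ := if v = b w then 1 else 0

lemma kdet_kernel {W V : Type*} [Fintype V] (b : W → V) : IsKernel (kdet b) := by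
  classical
  intro w
  refine ⟨fun v => ?_, ?_⟩
  · unfold kdet; split_ifs <;> norm_num
  · simp [kdet]

lemma ES_det_le {U W M V : Type*} [Fintype U] [Fintype W] [Fintype M] [Fintype V] {n : ℕ}
    (p : (Fin n → U) → M → ℝ) (f : Fin n → M → W) (d : U → V → ℝ)
    (b : W → V)
    (ha : ∀ t m v, ∑ un, p un m * d (un t) (b (f t m)) ≤ ∑ un, p un m * d (un t) v)
    (τ : M → (Fin n → V) → ℝ) (hτ : IsKernel τ) :
    ES (JJ p f) d (kdet b) ≤ DB p d τ := by
  classical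
  have h1 : ES (JJ p f) d (kdet b) =
      ∑ m, ∑ vn, τ m vn * ((n:ℝ)⁻¹ * ∑ t, ∑ un, p un m * d (un t) (b (f t m))) := by
    rw [ES_JJ]
    simp only [← Finset.sum_mul, (hτ _).2, one_mul, ← Finset.mul_sum]
    congr 1
    rw [Finset.sum_comm (s := (Finset.univ : Finset M))]
    refine Finset.sum_congr rfl fun t _ => ?_
    rw [Finset.sum_comm]
    simp [kdet]
  have h2 : DB p d τ =
      ∑ m, ∑ vn, τ m vn * ((n:ℝ)⁻¹ * ∑ t, ∑ un, p un m * d (un t) (vn t)) := by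
    rw [DB, Finset.sum_comm]
    refine Finset.sum_congr rfl fun m _ => ?_
    rw [Finset.sum_comm]
    refine Finset.sum_congr rfl fun vn _ => ?_
    rw [Finset.sum_comm]
    simp only [Finset.mul_sum]
    refine Finset.sum_congr rfl fun un _ => Finset.sum_congr rfl fun t _ => ?_
    ring
  rw [h1, h2]
  refine Finset.sum_le_sum fun m _ => Finset.sum_le_sum fun vn _ => ?_
  refine mul_le_mul_of_nonneg_left ?_ ((hτ m).1 vn)
  refine mul_le_mul_of_nonneg_left ?_ (by positivity)
  exact Finset.sum_le_sum fun t _ => ha t m _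

lemma kernel_le_one {α β : Type*} [Fintype β] {k : α → β → ℝ} (hk : IsKernel k) (a b) :
    k a b ≤ 1 := by
  rw [← (hk a).2]
  exact Finset.single_le_sum (fun m _ => (hk a).1 m) (Finset.mem_univ b)


lemma JJ_snd {U W1 W2 M1 M2 : Type*} [Fintype U] [Fintype W1] [Fintype W2]
    [Fintype M1] [Fintype M2] {n : ℕ}
    (p : (Fin n → U) → M1 × M2 → ℝ) (f1 : Fin n → M1 × M2 → W1) (f2 : Fin n → M2 → W2)
    (u : U) (w2 : W2) :
    ∑ w1, JJ p (fun t m => (f1 t m, f2 t m.2)) (u, (w1, w2)) =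
      JJ (fun un m2 => ∑ m1, p un (m1, m2)) f2 (u, w2) := by
  classical
  have h1 := JJ_sum p (fun t m => (f1 t m, f2 t m.2))
    (fun z => if z.1 = u ∧ z.2.2 = w2 then 1 else 0)
  have h2 := JJ_sum (fun un m2 => ∑ m1, p un (m1, m2)) f2
    (fun z => if z.1 = u ∧ z.2 = w2 then 1 else 0)
  have e1 : ∑ z : U × (W1 × W2), JJ p (fun t m => (f1 t m, f2 t m.2)) z *
      (if z.1 = u ∧ z.2.2 = w2 then (1:ℝ) else 0) =
      ∑ w1, JJ p (fun t m => (f1 t m, f2 t m.2)) (u, (w1, w2)) := by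
    simp [Fintype.sum_prod_type, ite_and]
  have e2 : ∑ z : U × W2, JJ (fun un m2 => ∑ m1, p un (m1, m2)) f2 z *
      (if z.1 = u ∧ z.2 = w2 then (1:ℝ) else 0) =
      JJ (fun un m2 => ∑ m1, p un (m1, m2)) f2 (u, w2) := by
    simp [Fintype.sum_prod_type, ite_and]
  rw [← e1, ← e2, h1, h2]
  congr 1
  refine Finset.sum_congr rfl fun t _ => Finset.sum_congr rfl fun un _ => ?_
  rw [Fintype.sum_prod_type_right]
  simp only [Finset.sum_mul]

lemma Ee_eq {U V1 V2 W1 W2 M1 M2 : Type*} [Fintype U] [Fintype V1] [Fintype V2]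
    [Fintype W1] [Fintype W2] [Fintype M1] [Fintype M2] {n : ℕ}
    (PU : U → ℝ) (de : U → V1 → V2 → ℝ) (σ : (Fin n → U) → M1 × M2 → ℝ)
    (f1 : Fin n → M1 × M2 → W1) (f2 : Fin n → M2 → W2) (Q : U → W1 × W2 → ℝ)
    (hQ : ∀ u w, PU u * Q u w =
      JJ (fun un m => (∏ t, PU (un t)) * σ un m) (fun t m => (f1 t m, f2 t m.2)) (u, w))
    (k1 : W1 × W2 → V1 → ℝ) (hk1 : IsKernel k1) (k2 : W2 → V2 → ℝ) (hk2 : IsKernel k2) :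
    Ee PU de Q k1 k2 = deN PU de σ (fun m vn => ∏ t, k1 (f1 t m, f2 t m.2) (vn t))
      (fun m2 vn => ∏ t, k2 (f2 t m2) (vn t)) := by
  classical
  have h := JJ_sum (fun un m => (∏ t, PU (un t)) * σ un m) (fun t m => (f1 t m, f2 t m.2))
    (fun z => ∑ v1, k1 z.2 v1 * ∑ v2, k2 z.2.2 v2 * de z.1 v1 v2)
  have hL : Ee PU de Q k1 k2 = ∑ z, JJ (fun un m => (∏ t, PU (un t)) * σ un m)
      (fun t m => (f1 t m, f2 t m.2)) z *
      (∑ v1, k1 z.2 v1 * ∑ v2, k2 z.2.2 v2 * de z.1 v1 v2) := by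
    rw [Fintype.sum_prod_type]
    simp only [Ee, hQ, Finset.mul_sum, mul_assoc]
  rw [hL, h]
  have key : ∀ (un : Fin n → U) (m : M1 × M2),
      ∑ v1n : Fin n → V1, ∑ v2n : Fin n → V2,
      ((∏ t, PU (un t)) * σ un m * (∏ t, k1 (f1 t m, f2 t m.2) (v1n t)) *
        (∏ t, k2 (f2 t m.2) (v2n t))) * ((n : ℝ)⁻¹ * ∑ t, de (un t) (v1n t) (v2n t)) =
      ∑ t, (n : ℝ)⁻¹ * ((∏ t, PU (un t)) * σ un m *
        ∑ v1, k1 (f1 t m, f2 t m.2) v1 * ∑ v2, k2 (f2 t m.2) v2 * de (un t) v1 v2) := by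
    intro un m
    have step : ∀ t : Fin n, ∑ v1, k1 (f1 t m, f2 t m.2) v1 * ∑ v2, k2 (f2 t m.2) v2 *
        de (un t) v1 v2 = ∑ v1n : Fin n → V1, (∏ s, k1 (f1 s m, f2 s m.2) (v1n s)) *
          ∑ v2n : Fin n → V2, (∏ s, k2 (f2 s m.2) (v2n s)) * de (un t) (v1n t) (v2n t) := by
      intro t
      rw [← prod_marg (fun s => k1 (f1 s m, f2 s m.2)) (fun s => (hk1 _).2) t
        (fun v1 => ∑ v2, k2 (f2 t m.2) v2 * de (un t) v1 v2)]
      refine Finset.sum_congr rfl fun v1n _ => ?_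
      rw [← prod_marg (fun s => k2 (f2 s m.2)) (fun s => (hk2 _).2) t
        (fun v2 => de (un t) (v1n t) v2)]
    simp only [step]
    simp only [Finset.mul_sum]
    rw [Finset.sum_comm (s := (Finset.univ : Finset (Fin n)))]
    refine Finset.sum_congr rfl fun v1n _ => ?_
    rw [Finset.sum_comm (s := (Finset.univ : Finset (Fin n)))]
    refine Finset.sum_congr rfl fun v2n _ => Finset.sum_congr rfl fun t _ => ?_
    ring
  have hR : deN PU de σ (fun m vn => ∏ t, k1 (f1 t m, f2 t m.2) (vn t))
      (fun m2 vn => ∏ t, k2 (f2 t m2) (vn t)) = ∑ un : Fin n → U, ∑ m : M1 × M2,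
      ∑ t, (n : ℝ)⁻¹ * ((∏ t, PU (un t)) * σ un m *
        ∑ v1, k1 (f1 t m, f2 t m.2) v1 * ∑ v2, k2 (f2 t m.2) v2 * de (un t) v1 v2) := by
    simp only [← key]
    simp only [deN, Fintype.sum_prod_type (α₁ := M1)]
  rw [hR, Finset.mul_sum]
  simp only [Finset.mul_sum (s := (Finset.univ : Finset (Fin n → U))),
    Finset.mul_sum (s := (Finset.univ : Finset (M1 × M2)))]
  rw [Finset.sum_comm]
  refine Finset.sum_congr rfl fun un _ => ?_
  rw [Finset.sum_comm]

lemma d1N_eq_s2 {U V1 M1 M2 : Type*} [Fintype U] [Fintype V1] [Fintype M1] [Fintype M2] {n : ℕ}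
    (PU : U → ℝ) (d1 : U → V1 → ℝ) (σ : (Fin n → U) → M1 × M2 → ℝ)
    (τ : M1 × M2 → (Fin n → V1) → ℝ) :
    d1N PU d1 σ τ = DB (fun un m => (∏ t, PU (un t)) * σ un m) d1 τ := by
  simp only [d1N, DB, Fintype.sum_prod_type (α₁ := M1)]

lemma d2N_eq_s2 {U V2 M1 M2 : Type*} [Fintype U] [Fintype V2] [Fintype M1] [Fintype M2] {n : ℕ}
    (PU : U → ℝ) (d2 : U → V2 → ℝ) (σ : (Fin n → U) → M1 × M2 → ℝ)
    (τ : M2 → (Fin n → V2) → ℝ) :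
    d2N PU d2 σ τ = DB (fun un m2 => ∑ m1, (∏ t, PU (un t)) * σ un (m1, m2)) d2 τ := by
  simp only [d2N, DB]
  refine Finset.sum_congr rfl fun un _ => ?_
  rw [Finset.sum_comm]
  refine Finset.sum_congr rfl fun m2 _ => ?_
  rw [Finset.sum_comm]
  refine Finset.sum_congr rfl fun vn _ => ?_
  rw [Finset.sum_mul, Finset.sum_mul]

lemma deN_bdd {U V1 V2 M1 M2 : Type*} [Fintype U] [Fintype V1] [Fintype V2]
    [Fintype M1] [Fintype M2] {n : ℕ}
    (PU : U → ℝ) (de : U → V1 → V2 → ℝ) (σ : (Fin n → U) → M1 × M2 → ℝ) :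
    ∃ C : ℝ, ∀ τ1 τ2, IsKernel τ1 → IsKernel τ2 → deN PU de σ τ1 τ2 ≤ C := by
  refine ⟨∑ un : Fin n → U, ∑ m1 : M1, ∑ m2 : M2, ∑ v1n : Fin n → V1, ∑ v2n : Fin n → V2,
    |((∏ t, PU (un t)) * σ un (m1, m2)) * ((n : ℝ)⁻¹ * ∑ t, de (un t) (v1n t) (v2n t))|, ?_⟩
  intro τ1 τ2 h1 h2
  unfold deN
  refine Finset.sum_le_sum fun un _ => Finset.sum_le_sum fun m1 _ => Finset.sum_le_sum fun m2 _ =>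
    Finset.sum_le_sum fun v1n _ => Finset.sum_le_sum fun v2n _ => ?_
  have ha := kernel_le_one h1 (m1, m2) v1n
  have hb := kernel_le_one h2 m2 v2n
  have ha0 := (h1 (m1, m2)).1 v1n
  have hb0 := (h2 m2).1 v2n
  calc _ = (τ1 (m1, m2) v1n * τ2 m2 v2n) * (((∏ t, PU (un t)) * σ un (m1, m2)) *
        ((n : ℝ)⁻¹ * ∑ t, de (un t) (v1n t) (v2n t))) := by ring
    _ ≤ (τ1 (m1, m2) v1n * τ2 m2 v2n) * |((∏ t, PU (un t)) * σ un (m1, m2)) *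
        ((n : ℝ)⁻¹ * ∑ t, de (un t) (v1n t) (v2n t))| :=
        mul_le_mul_of_nonneg_left (le_abs_self _) (mul_nonneg ha0 hb0)
    _ ≤ _ := mul_le_of_le_one_left (abs_nonneg _) (mul_le_one₀ ha hb0 hb)

lemma Ee_bdd {U V1 V2 : Type*} (W1 W2 : Type*) [Fintype U] [Fintype V1] [Fintype V2]
    [Fintype W1] [Fintype W2]
    (PU : U → ℝ) (de : U → V1 → V2 → ℝ) :
    ∃ C : ℝ, 0 ≤ C ∧ ∀ (Q : U → W1 × W2 → ℝ) k1 k2, IsKernel Q → IsKernel k1 → IsKernel k2 →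
      |Ee PU de Q k1 k2| ≤ C := by
  refine ⟨∑ u, ∑ w : W1 × W2, ∑ v1, ∑ v2, |PU u * de u v1 v2|, by positivity, ?_⟩
  intro Q k1 k2 hQ h1 h2
  unfold Ee
  refine (Finset.abs_sum_le_sum_abs _ _).trans (Finset.sum_le_sum fun u _ => ?_)
  refine (Finset.abs_sum_le_sum_abs _ _).trans (Finset.sum_le_sum fun w _ => ?_)
  refine (Finset.abs_sum_le_sum_abs _ _).trans (Finset.sum_le_sum fun v1 _ => ?_)
  refine (Finset.abs_sum_le_sum_abs _ _).trans (Finset.sum_le_sum fun v2 _ => ?_)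
  have ha := kernel_le_one h1 w v1
  have hb := kernel_le_one h2 w.2 v2
  have hc := kernel_le_one hQ u w
  have ha0 := (h1 w).1 v1
  have hb0 := (h2 w.2).1 v2
  have hc0 := (hQ u).1 w
  have : PU u * Q u w * k1 w v1 * k2 w.2 v2 * de u v1 v2 =
    (Q u w * k1 w v1 * k2 w.2 v2) * (PU u * de u v1 v2) := by ring
  rw [this, abs_mul, abs_of_nonneg (by positivity)]
  exact mul_le_of_le_one_left (abs_nonneg _) (mul_le_one₀ (mul_le_one₀ hc ha0 ha) hb0 hb)

lemma exists_Q {U V1 V2 M1 M2 : Type*} [Fintype U] [Fintype V1] [Fintype V2]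
    [Fintype M1] [Fintype M2] [Nonempty M1] [Nonempty M2]
    {W1 W2 : Type*} [Fintype W1] [Fintype W2] [Nonempty V1] [Nonempty V2]
    (e1 : V1 ≃ W1) (e2 : V2 ≃ W2)
    (PU : U → ℝ) (hPU : IsDist PU)
    (de : U → V1 → V2 → ℝ) (d1 : U → V1 → ℝ) (d2 : U → V2 → ℝ)
    (R1 R2 : ℝ) (n : ℕ) (hn : 1 ≤ n)
    (hM2 : Real.logb 2 (Fintype.card M2) ≤ n * R2)
    (hM12 : Real.logb 2 (Fintype.card (M1 × M2)) ≤ n * (R1 + R2))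
    (σ : (Fin n → U) → M1 × M2 → ℝ) (hσ : IsKernel σ) :
    ∃ Q : U → W1 × W2 → ℝ, Q ∈ Q0set PU R1 R2 ∧
      sSup {y | ∃ k1 ∈ Q1set PU d1 Q, ∃ k2 ∈ Q2set PU d2 Q, y = Ee PU de Q k1 k2}
        ≤ DeWorst PU de d1 d2 σ := by
  classical
  have hn0 : (0:ℝ) < n := by exact_mod_cast hn
  set p : (Fin n → U) → M1 × M2 → ℝ := fun un m => (∏ t, PU (un t)) * σ un m with hp
  set p2 : (Fin n → U) → M2 → ℝ := fun un m2 => ∑ m1, p un (m1, m2) with hp2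
  have hp0 : ∀ un m, 0 ≤ p un m := fun un m =>
    mul_nonneg (Finset.prod_nonneg fun t _ => hPU.1 _) ((hσ un).1 m)
  choose a1 ha1 using fun (t : Fin n) (m : M1 × M2) =>
    Finite.exists_min (fun v : V1 => ∑ un, p un m * d1 (un t) v)
  choose a2 ha2 using fun (t : Fin n) (m : M2) =>
    Finite.exists_min (fun v : V2 => ∑ un, p2 un m * d2 (un t) v)
  set f1 : Fin n → M1 × M2 → W1 := fun t m => e1 (a1 t m) with hf1
  set f2 : Fin n → M2 → W2 := fun t m => e2 (a2 t m) with hf2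
  set f : Fin n → M1 × M2 → W1 × W2 := fun t m => (f1 t m, f2 t m.2) with hf
  have hj0 : ∀ z, 0 ≤ JJ p f z := JJ_nonneg p hp0 f
  have hmarg : ∀ u, ∑ w, JJ p f (u, w) = PU u := fun u => JJ_marg hn PU hPU σ hσ f u
  obtain ⟨v1⟩ := ‹Nonempty V1›
  obtain ⟨v2⟩ := ‹Nonempty V2›
  set Q : U → W1 × W2 → ℝ := fun u w =>
    if PU u = 0 then (if w = (e1 v1, e2 v2) then 1 else 0) else JJ p f (u, w) / PU u with hQdef
  have hQk : IsKernel Q := by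
    intro u
    rw [hQdef]
    by_cases h : PU u = 0
    · simp only [h, if_true]
      refine ⟨fun w => ?_, by simp⟩
      dsimp only
      split_ifs <;> norm_num
    · simp only [h, if_false]
      refine ⟨fun w => div_nonneg (hj0 _) (hPU.1 u), ?_⟩
      rw [← Finset.sum_div, hmarg, div_self h]
  have hQ : ∀ u w, PU u * Q u w = JJ p f (u, w) := by
    intro u w
    rw [hQdef]
    by_cases h : PU u = 0
    · simp only [h, zero_mul]
      have h0 := hmarg u
      rw [h, Finset.sum_eq_zero_iff_of_nonneg (fun w _ => hj0 _)] at h0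
      exact (h0 w (Finset.mem_univ w)).symm
    · simp only [h, if_false]
      field_simp
  have hsnd : ∀ u w2, ∑ w1, JJ p f (u, (w1, w2)) = JJ p2 f2 (u, w2) := fun u w2 =>
    JJ_snd p f1 f2 u w2
  have hE1 : ∀ k : W1 × W2 → V1 → ℝ, E1 PU d1 Q k = ES (JJ p f) d1 k := by
    intro k; simp only [E1, ES, hQ]
  have hE2 : ∀ k : W2 → V2 → ℝ, E2 PU d2 Q k = ES (JJ p2 f2) d2 k := by
    intro k; simp only [E2, ES, Finset.mul_sum, hQ, hsnd]
  -- information constraints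
  have hs2 : IsKernel (fun un m2 => ∑ m1, σ un (m1, m2)) := by
    intro un
    refine ⟨fun m2 => Finset.sum_nonneg fun m1 _ => (hσ un).1 _, ?_⟩
    rw [← (hσ un).2, Fintype.sum_prod_type_right]
  have hp2' : p2 = fun un m2 => (∏ t, PU (un t)) * ∑ m1, σ un (m1, m2) := by
    funext un m2
    simp only [hp2, hp, Finset.mul_sum]
  have hI2 := info hn PU hPU _ hs2 f2 Fintype.card_pos
  have hI12 := info hn PU hPU σ hσ f Fintype.card_pos
  rw [← hp2'] at hI2
  have hb1 : ∀ τ, IsKernel τ → ES (JJ p f) d1 (kdet fun w => e1.symm w.1) ≤ DB p d1 τ :=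
    fun τ hτ => ES_det_le p f d1 (fun w => e1.symm w.1)
      (fun t m v => by simpa [hf, hf1] using ha1 t m v) τ hτ
  have hb2 : ∀ τ, IsKernel τ → ES (JJ p2 f2) d2 (kdet fun w => e2.symm w) ≤ DB p2 d2 τ :=
    fun τ hτ => ES_det_le p2 f2 d2 (fun w => e2.symm w)
      (fun t m v => by simpa [hf2] using ha2 t m v) τ hτ
  refine ⟨Q, ⟨hQk, ?_, ?_⟩, ?_⟩
  · simp only [hQ, hsnd]
    exact le_of_mul_le_mul_left (hI2.trans hM2) hn0
  · simp only [hQ]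
    exact le_of_mul_le_mul_left (hI12.trans hM12) hn0
  · apply csSup_le
    · refine ⟨_, kdet (fun w => e1.symm w.1), ⟨kdet_kernel _, ?_⟩,
        kdet (fun w => e2.symm w), ⟨kdet_kernel _, ?_⟩, rfl⟩
      · intro k hk
        rw [hE1, hE1, ← ES_eq_DB p f d1 k hk]
        exact hb1 _ (prod_kernel (fun t m => k (f t m)) fun t m => hk _)
      · intro k hk
        rw [hE2, hE2, ← ES_eq_DB p2 f2 d2 k hk]
        exact hb2 _ (prod_kernel (fun t m => k (f2 t m)) fun t m => hk _)
    · rintro y ⟨k1, ⟨hk1, hk1'⟩, k2, ⟨hk2, hk2'⟩, rfl⟩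
      obtain ⟨C, hC⟩ := deN_bdd PU de σ
      refine le_csSup ⟨C, ?_⟩ ?_
      · rintro y ⟨τ1, h1, τ2, h2, rfl⟩
        exact hC τ1 τ2 h1.1 h2.1
      · refine ⟨_, ⟨prod_kernel (fun t m => k1 (f t m)) fun t m => hk1 _, ?_⟩,
          _, ⟨prod_kernel (fun t m => k2 (f2 t m)) fun t m => hk2 _, ?_⟩,
          Ee_eq PU de σ f1 f2 Q hQ k1 hk1 k2 hk2⟩
        · intro τ hτ
          rw [d1N_eq_s2, d1N_eq_s2]
          refine le_trans ?_ (hb1 τ hτ)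
          have := hk1' _ (kdet_kernel fun w => e1.symm w.1)
          rw [hE1, hE1] at this
          exact (ES_eq_DB p f d1 k1 hk1).le.trans this
        · intro τ hτ
          rw [d2N_eq_s2, d2N_eq_s2]
          refine le_trans ?_ (hb2 τ hτ)
          have := hk2' _ (kdet_kernel fun w => e2.symm w)
          rw [hE2, hE2] at this
          exact (ES_eq_DB p2 f2 d2 k2 hk2).le.trans this

lemma logb_card_le (x : ℝ) (hx : 0 ≤ x) : Real.logb 2 ((2 ^ ⌊x⌋₊ : ℕ) : ℝ) ≤ x := by
  push_cast
  rw [Real.logb_pow, Real.logb_self_eq_one (by norm_num), mul_one]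
  exact Nat.floor_le hx

/-- converse: for all rates `R1, R2 ≥ 0` and every blocklength
`n ≥ 1`, `D_e^n(R1,R2) ≥ D_e*(R1,R2)`. -/
theorem stmt2_converse
    {U V1 V2 : Type*} [Fintype U] [Fintype V1] [Fintype V2]
    (W1 W2 : Type*) [Fintype W1] [Fintype W2]
    (hW1 : Fintype.card W1 = Fintype.card V1)
    (hW2 : Fintype.card W2 = Fintype.card V2)
    (PU : U → ℝ) (hPU : IsDist PU)
    (de : U → V1 → V2 → ℝ) (d1 : U → V1 → ℝ) (d2 : U → V2 → ℝ)
    (R1 R2 : ℝ) (hR1 : 0 ≤ R1) (hR2 : 0 ≤ R2)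
    (n : ℕ) (hn : 1 ≤ n) :
    Dstar W1 W2 PU de d1 d2 R1 R2 ≤ Dn PU de d1 d2 R1 R2 n := by
  classical
  have hne : {x | ∃ σ : (Fin n → U) → Msg R1 n × Msg R2 n → ℝ, IsKernel σ ∧
    x = DeWorst PU de d1 d2 σ}.Nonempty :=
    ⟨_, kdet (fun _ => (⟨0, by positivity⟩, ⟨0, by positivity⟩)), kdet_kernel _, rfl⟩
  have hUne : Nonempty U := by
    by_contra h
    rw [not_nonempty_iff] at h
    have := hPU.2
    simp at this
  have e1 : V1 ≃ W1 := Fintype.equivOfCardEq hW1.symm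
  have e2 : V2 ≃ W2 := Fintype.equivOfCardEq hW2.symm
  have hx1 : (0:ℝ) ≤ n * R1 := by positivity
  have hx2 : (0:ℝ) ≤ n * R2 := by positivity
  by_cases hV : Nonempty V1 ∧ Nonempty V2
  · obtain ⟨hV1, hV2⟩ := hV
    refine le_csInf hne ?_
    rintro x ⟨σ, hσ, rfl⟩
    haveI : Nonempty (Msg R1 n) := ⟨⟨0, by positivity⟩⟩
    haveI : Nonempty (Msg R2 n) := ⟨⟨0, by positivity⟩⟩
    obtain ⟨Q, hQ, hle⟩ := exists_Q e1 e2 PU hPU de d1 d2 R1 R2 n hn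
      (by rw [Fintype.card_fin]; exact logb_card_le _ hx2)
      (by
        rw [Fintype.card_prod, Fintype.card_fin, Fintype.card_fin, Nat.cast_mul,
          Real.logb_mul (by positivity) (by positivity), mul_add]
        exact add_le_add (logb_card_le _ hx1) (logb_card_le _ hx2)) σ hσ
    refine le_trans (csInf_le ?_ ⟨Q, hQ, rfl⟩) hle
    obtain ⟨C, hC0, hC⟩ := Ee_bdd W1 W2 PU de
    refine ⟨-C, ?_⟩
    rintro x ⟨Q, hQ, rfl⟩
    rcases Set.eq_empty_or_nonempty {y | ∃ k1 ∈ Q1set PU d1 Q, ∃ k2 ∈ Q2set PU d2 Q,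
      y = Ee PU de Q k1 k2} with h | ⟨y, hy⟩
    · rw [h, Real.sSup_empty]; linarith
    · refine le_csSup_of_le ⟨C, ?_⟩ hy ?_
      · rintro y ⟨k1, h1, k2, h2, rfl⟩
        exact (abs_le.mp (hC Q k1 k2 hQ.1 h1.1 h2.1)).2
      · obtain ⟨k1, h1, k2, h2, rfl⟩ := hy
        exact (abs_le.mp (hC Q k1 k2 hQ.1 h1.1 h2.1)).1
  · have hWe : IsEmpty (W1 × W2) := by
      rw [← not_nonempty_iff]
      rintro ⟨w1, w2⟩
      exact hV ⟨⟨e1.symm w1⟩, ⟨e2.symm w2⟩⟩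
    have hD : Dstar W1 W2 PU de d1 d2 R1 R2 = 0 := by
      unfold Dstar
      convert Real.sInf_empty
      rw [Set.eq_empty_iff_forall_notMem]
      rintro x ⟨Q, hQ, -⟩
      have := (hQ.1 hUne.some).2
      simp at this
    rw [hD]
    refine le_csInf hne ?_
    rintro x ⟨σ, hσ, rfl⟩
    unfold DeWorst
    apply Real.sSup_nonneg
    rintro y ⟨τ1, h1, τ2, h2, rfl⟩
    exfalso
    apply hV
    constructor
    · by_contra h
      rw [not_nonempty_iff] at h
      haveI : Nonempty (Fin n) := ⟨⟨0, hn⟩⟩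
      have := (h1.1 (⟨0, by positivity⟩, ⟨0, by positivity⟩)).2
      simp at this
    · by_contra h
      rw [not_nonempty_iff] at h
      haveI : Nonempty (Fin n) := ⟨⟨0, hn⟩⟩
      have := (h2.1 ⟨0, by positivity⟩).2
      simp at this

end Persuasion
end

section
/- Let (σ,τ1,τ2) be any strategy triple at blocklength n and let T be uniformly distributed on {1,…,n} and independent of (U^n,M1,M2,V1^n,V2^n) under P^{σ,τ1,τ2}. Define W1 = (M1,T), W2 = (M2,T), U = U_T, V1 = V_{1,T}, V2 = V_{2,T}. Then the joint distribution of (U,W1,W2,V1,V2) has marginal P_U on U and factorizes as P_U · P_{W1W2|U} · P_{V1|W1W2} · P_{V2|W2}; equivalently, the Markov chains (U,V2) − (W1,W2) − V1 and (U,W1,V1) − W2 − V2 hold. -/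
open scoped BigOperators

namespace Persuasion

section SingleLetterization

variable {U V1 V2 M1 M2 : Type*} [Fintype U] [Fintype V1] [Fintype V2]
  [Fintype M1] [Fintype M2] [DecidableEq U] [DecidableEq V1] [DecidableEq V2]

/-- Joint distribution of `(U_T, (M1,T), (M2,T), V_{1,T}, V_{2,T})` where `T`
is uniform on `{1,…,n}` and independent of everything else. -/
noncomputable def slJoint (PU : U → ℝ) {n : ℕ}
    (σ : (Fin n → U) → M1 × M2 → ℝ)
    (τ1 : M1 × M2 → (Fin n → V1) → ℝ)
    (τ2 : M2 → (Fin n → V2) → ℝ)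
    (u : U) (w1 : M1 × Fin n) (w2 : M2 × Fin n) (v1 : V1) (v2 : V2) : ℝ :=
  if w1.2 = w2.2 then
    (n : ℝ)⁻¹ * ∑ un : Fin n → U, ∑ v1n : Fin n → V1, ∑ v2n : Fin n → V2,
      (if un w1.2 = u ∧ v1n w1.2 = v1 ∧ v2n w1.2 = v2 then
        (∏ t, PU (un t)) * σ un (w1.1, w2.1) * τ1 (w1.1, w2.1) v1n * τ2 w2.1 v2n
      else 0)
  else 0

/-- Product law of the coordinates other than `t`, with coordinate `t` frozen to `u`. -/
noncomputable def gAux (PU : U → ℝ) {n : ℕ} (t : Fin n) (u : U) (un : Fin n → U) : ℝ :=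
  ∏ s, (if s = t then (if un s = u then (1 : ℝ) else 0) else PU (un s))

theorem gAux_nonneg (PU : U → ℝ) (h : ∀ a, 0 ≤ PU a) {n : ℕ} (t : Fin n) (u : U)
    (un : Fin n → U) : 0 ≤ gAux PU t u un := by
  unfold gAux
  refine Finset.prod_nonneg fun s _ => ?_
  split_ifs
  · exact zero_le_one
  · exact le_rfl
  · exact h _

theorem gAux_sum (PU : U → ℝ) (h : ∑ a, PU a = 1) {n : ℕ} (t : Fin n) (u : U) :
    ∑ un : Fin n → U, gAux PU t u un = 1 := by
  unfold gAux
  have := Fintype.prod_sum (fun (s : Fin n) (a : U) =>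
    (if s = t then (if a = u then (1 : ℝ) else 0) else PU a))
  rw [← this]
  refine Finset.prod_eq_one fun s _ => ?_
  by_cases hs : s = t
  · simp [hs]
  · simp [hs, h]

theorem gAux_eq (PU : U → ℝ) {n : ℕ} (t : Fin n) (u : U) (un : Fin n → U) :
    (if un t = u then ∏ s, PU (un s) else 0) = PU u * gAux PU t u un := by
  unfold gAux
  rw [← Finset.mul_prod_erase Finset.univ _ (Finset.mem_univ t),
    ← Finset.mul_prod_erase Finset.univ
      (fun s => (if s = t then (if un s = u then (1 : ℝ) else 0) else PU (un s)))
      (Finset.mem_univ t)]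
  have : ∏ s ∈ Finset.univ.erase t,
      (if s = t then (if un s = u then (1 : ℝ) else 0) else PU (un s))
      = ∏ s ∈ Finset.univ.erase t, PU (un s) := by
    refine Finset.prod_congr rfl fun s hs => ?_
    rw [if_neg (Finset.ne_of_mem_erase hs)]
  rw [this]
  by_cases hu : un t = u
  · simp [hu]
  · simp [hu]

/-- The `t`-th marginal. -/
noncomputable def margAux {n : ℕ} (p : (Fin n → V1) → ℝ) (t : Fin n) (v : V1) : ℝ :=
  ∑ vn : Fin n → V1, if vn t = v then p vn else 0

theorem margAux_dist {n : ℕ} (p : (Fin n → V1) → ℝ) (hp : IsDist p) (t : Fin n) :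
    IsDist (margAux p t) := by
  refine ⟨fun v => ?_, ?_⟩
  · refine Finset.sum_nonneg fun vn _ => ?_
    split_ifs
    · exact hp.1 _
    · exact le_rfl
  · unfold margAux
    rw [Finset.sum_comm]
    simpa using hp.2

/-- Conditional law of `(W1, W2)` given `U`. -/
noncomputable def kAux (PU : U → ℝ) {n : ℕ} (σ : (Fin n → U) → M1 × M2 → ℝ)
    (u : U) (w : (M1 × Fin n) × (M2 × Fin n)) : ℝ :=
  if w.1.2 = w.2.2 then
    (n : ℝ)⁻¹ * ∑ un : Fin n → U, gAux PU w.1.2 u un * σ un (w.1.1, w.2.1) else 0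

theorem kAux_kernel (PU : U → ℝ) (hPU : IsDist PU) {n : ℕ} (hn : 1 ≤ n)
    (σ : (Fin n → U) → M1 × M2 → ℝ) (hσ : IsKernel σ) : IsKernel (kAux PU σ) := by
  intro u
  refine ⟨fun w => ?_, ?_⟩
  · unfold kAux
    split_ifs
    · exact mul_nonneg (by positivity) (Finset.sum_nonneg fun un _ =>
        mul_nonneg (gAux_nonneg PU hPU.1 _ _ _) ((hσ un).1 _))
    · exact le_rfl
  · unfold kAux
    simp only [Fintype.sum_prod_type, Finset.sum_ite_eq, Finset.mem_univ, if_true]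
    have key : ∀ t : Fin n, ∑ m1 : M1, ∑ m2 : M2,
        (n : ℝ)⁻¹ * ∑ un : Fin n → U, gAux PU t u un * σ un (m1, m2) = (n : ℝ)⁻¹ := by
      intro t
      simp only [← Finset.mul_sum]
      have h1 : ∑ m1 : M1, ∑ m2 : M2, ∑ un : Fin n → U, gAux PU t u un * σ un (m1, m2)
          = ∑ un : Fin n → U, gAux PU t u un * ∑ m : M1 × M2, σ un m := by
        rw [← Fintype.sum_prod_type' (fun m1 m2 => ∑ un : Fin n → U,
          gAux PU t u un * σ un (m1, m2)), Finset.sum_comm]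
        simp only [Finset.mul_sum]
      rw [h1]
      simp only [(hσ _).2, mul_one, gAux_sum PU hPU.2, mul_one]
    rw [Finset.sum_comm]
    simp only [key]
    have : (n : ℝ) ≠ 0 := by positivity
    simp [this]

theorem slJoint_eq (PU : U → ℝ) {n : ℕ}
    (σ : (Fin n → U) → M1 × M2 → ℝ)
    (τ1 : M1 × M2 → (Fin n → V1) → ℝ)
    (τ2 : M2 → (Fin n → V2) → ℝ)
    (u : U) (w1 : M1 × Fin n) (w2 : M2 × Fin n) (v1 : V1) (v2 : V2) :
    slJoint PU σ τ1 τ2 u w1 w2 v1 v2 = PU u * kAux PU σ u (w1, w2) *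
      margAux (τ1 (w1.1, w2.1)) w1.2 v1 * margAux (τ2 w2.1) w2.2 v2 := by
  unfold slJoint kAux
  by_cases h : w1.2 = w2.2
  · simp only [h, if_true]
    have h1 : ∀ (un : Fin n → U) (v1n : Fin n → V1) (v2n : Fin n → V2),
        (if un w2.2 = u ∧ v1n w2.2 = v1 ∧ v2n w2.2 = v2 then
        (∏ t, PU (un t)) * σ un (w1.1, w2.1) * τ1 (w1.1, w2.1) v1n * τ2 w2.1 v2n
        else 0) = (PU u * gAux PU w2.2 u un * σ un (w1.1, w2.1)) *
          (if v1n w2.2 = v1 then τ1 (w1.1, w2.1) v1n else 0) *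
          (if v2n w2.2 = v2 then τ2 w2.1 v2n else 0) := by
      intro un v1n v2n
      rw [← gAux_eq]
      by_cases a : un w2.2 = u <;> by_cases b : v1n w2.2 = v1 <;>
        by_cases c : v2n w2.2 = v2 <;> simp [a, b, c]
    simp only [h1, ← Finset.mul_sum, ← Finset.sum_mul]
    unfold margAux
    simp only [mul_assoc, ← Finset.mul_sum]
    ring
  · simp [h]

/-- the single-letterized joint law has marginal `P_U` on `U` and
factorizes as `P_U · P_{W1W2|U} · P_{V1|W1W2} · P_{V2|W2}` (equivalently, the
Markov chains `(U,V2) − (W1,W2) − V1` and `(U,W1,V1) − W2 − V2` hold). -/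
theorem stmt5_factorization
    (PU : U → ℝ) (hPU : IsDist PU) (n : ℕ) (hn : 1 ≤ n)
    (σ : (Fin n → U) → M1 × M2 → ℝ) (hσ : IsKernel σ)
    (τ1 : M1 × M2 → (Fin n → V1) → ℝ) (hτ1 : IsKernel τ1)
    (τ2 : M2 → (Fin n → V2) → ℝ) (hτ2 : IsKernel τ2) :
    (∀ u : U,
      (∑ w1 : M1 × Fin n, ∑ w2 : M2 × Fin n, ∑ v1 : V1, ∑ v2 : V2,
        slJoint PU σ τ1 τ2 u w1 w2 v1 v2) = PU u) ∧
    ∃ (k1 : U → (M1 × Fin n) × (M2 × Fin n) → ℝ)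
      (k2 : (M1 × Fin n) × (M2 × Fin n) → V1 → ℝ)
      (k3 : M2 × Fin n → V2 → ℝ),
      IsKernel k1 ∧ IsKernel k2 ∧ IsKernel k3 ∧
      ∀ (u : U) (w1 : M1 × Fin n) (w2 : M2 × Fin n) (v1 : V1) (v2 : V2),
        slJoint PU σ τ1 τ2 u w1 w2 v1 v2 =
          PU u * k1 u (w1, w2) * k2 (w1, w2) v1 * k3 w2 v2 := by
  classical
  have hk := kAux_kernel PU hPU hn σ hσ
  have h2 : ∀ w : (M1 × Fin n) × (M2 × Fin n),
      IsDist (margAux (τ1 (w.1.1, w.2.1)) w.1.2) := fun w => margAux_dist _ (hτ1 _) _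
  have h3 : ∀ w : M2 × Fin n, IsDist (margAux (τ2 w.1) w.2) :=
    fun w => margAux_dist _ (hτ2 _) _
  refine ⟨fun u => ?_, kAux PU σ, fun w => margAux (τ1 (w.1.1, w.2.1)) w.1.2,
    fun w => margAux (τ2 w.1) w.2, hk, h2, h3, fun u w1 w2 v1 v2 => slJoint_eq ..⟩
  simp only [slJoint_eq, ← Finset.mul_sum, (h3 _).2, mul_one]
  have h2' : ∀ (w1 : M1 × Fin n) (w2 : M2 × Fin n),
      ∑ v, margAux (τ1 (w1.1, w2.1)) w1.2 v = 1 := fun w1 w2 => (h2 (w1, w2)).2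
  simp only [h2', mul_one, ← Finset.mul_sum]
  rw [← Fintype.sum_prod_type' (fun w1 w2 => kAux PU σ u (w1, w2))]
  have := (hk u).2
  simp only [Prod.mk.eta, this, mul_one]

end SingleLetterization

end Persuasion
end
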